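/- Let δ ≥ 1, let N be an admissible norm with constant C_N, and let H_p, H_q be proper, geodesically complete, δ-hyperbolic, Busemann spaces. Set C₀ = (2853δC_N + 2^{851})². Let x = (x_p,x_q) and y = (y_p,y_q) be points of H = H_p⋈H_q with h(x) ≤ h(y), and let α = (α_p,α_q) be a geodesic segment of (H, d_{H,N}) from x to y. Then: (1) l_N(α) ≥ Δh(x,y) + d_r(x_q,y_q) + d_r(x_p,y_p) − 15C₀; (2) h⁺(α) ≥ h(y) + ½·d_r(x_p,y_p) − 3C₀; (3) h⁻(α) ≤ h(x) − ½·d_r(x_q,y_q) + 3C₀. -/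

import Mathlib

open Set Filter
open scoped ENNReal NNReal

noncomputable section

namespace HP

variable {H : Type*} [MetricSpace H]

/-- `γ` restricted to `I` is an arclength-parametrised (isometric) geodesic. -/
def IsGeodesicOn (γ : ℝ → H) (I : Set ℝ) : Prop :=
  ∀ s ∈ I, ∀ t ∈ I, dist (γ s) (γ t) = |s - t|

/-- A geodesic line of `H`. -/
def IsGeodesicLine (γ : ℝ → H) : Prop := IsGeodesicOn γ Set.univ

/-- A geodesic ray of `H`, parametrised on `[0,∞)`. -/
def IsGeodesicRay (γ : ℝ → H) : Prop := IsGeodesicOn γ (Set.Ici 0)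

/-- A geodesic ray starting at `w`. -/
def IsRayFrom (w : H) (γ : ℝ → H) : Prop := IsGeodesicRay γ ∧ γ 0 = w

/-- A geodesic segment from `x` to `y`, parametrised on `[0, dist x y]`. -/
def IsGeodSegment (γ : ℝ → H) (x y : H) : Prop :=
  IsGeodesicOn γ (Set.Icc 0 (dist x y)) ∧ γ 0 = x ∧ γ (dist x y) = y

/-- The traces on `[0,∞)` of two rays are at finite Hausdorff distance. -/
def FinHausRays (γ₁ γ₂ : ℝ → H) : Prop :=
  ∃ C : ℝ, (∀ s : ℝ, 0 ≤ s → ∃ t : ℝ, 0 ≤ t ∧ dist (γ₁ s) (γ₂ t) ≤ C) ∧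
           (∀ t : ℝ, 0 ≤ t → ∃ s : ℝ, 0 ≤ s ∧ dist (γ₁ s) (γ₂ t) ≤ C)

/-- A geodesic metric space: any two points are joined by a geodesic segment. -/
def GeodesicSpace (H : Type*) [MetricSpace H] : Prop :=
  ∀ x y : H, ∃ γ : ℝ → H, IsGeodSegment γ x y

/-- `δ`-hyperbolicity: geodesic space all of whose geodesic triangles are `δ`-slim,
i.e. each side is contained in the `δ`-neighbourhood of the union of the other two. -/
def DeltaHyperbolic (H : Type*) [MetricSpace H] (δ : ℝ) : Prop :=
  GeodesicSpace H ∧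
  ∀ x y z : H, ∀ γ₁ γ₂ γ₃ : ℝ → H,
    IsGeodSegment γ₁ x y → IsGeodSegment γ₂ y z → IsGeodSegment γ₃ z x →
    ∀ s ∈ Set.Icc (0:ℝ) (dist x y),
      ∃ u ∈ γ₂ '' Set.Icc (0:ℝ) (dist y z) ∪ γ₃ '' Set.Icc (0:ℝ) (dist z x),
        dist (γ₁ s) u ≤ δ

/-- A Busemann space: geodesic, and the distance between any two
arclength-parametrised geodesics is a convex function. -/
def BusemannSpace (H : Type*) [MetricSpace H] : Prop :=
  GeodesicSpace H ∧
  ∀ (a b a' b' : ℝ) (γ γ' : ℝ → H),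
    IsGeodesicOn γ (Set.Icc a b) → IsGeodesicOn γ' (Set.Icc a' b') →
    ConvexOn ℝ (Set.Icc a b ×ˢ Set.Icc a' b')
      (fun p : ℝ × ℝ => dist (γ p.1) (γ' p.2))

/-- Geodesic completeness: every geodesic segment extends to a geodesic line. -/
def GeodesicallyComplete (H : Type*) [MetricSpace H] : Prop :=
  ∀ (a b : ℝ) (γ : ℝ → H), a ≤ b → IsGeodesicOn γ (Set.Icc a b) →
    ∃ γ' : ℝ → H, IsGeodesicLine γ' ∧ ∀ t ∈ Set.Icc a b, γ' t = γ t

/-- The Busemann function with respect to the boundary point represented by the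
geodesic ray `aRep` and the base point `w`. -/
def busemann (w : H) (aRep : ℝ → H) (x : H) : ℝ :=
  sSup { b : ℝ | ∃ k : ℝ → H, IsRayFrom w k ∧ FinHausRays aRep k ∧
    b = Filter.limsup (fun t => dist x (k t) - t) Filter.atTop }

/-- The height function: minus the Busemann function. -/
def height (w : H) (aRep : ℝ → H) (x : H) : ℝ := - busemann w aRep x

/-- A vertical geodesic (forward oriented): a geodesic line whose height tends to `+∞`. -/
def IsVerticalGeodesic (w : H) (aRep : ℝ → H) (V : ℝ → H) : Prop :=
  IsGeodesicLine V ∧ Tendsto (fun t => height w aRep (V t)) atTop atTop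

/-- A vertical geodesic line (either orientation): a geodesic line whose image lies
in the boundary class, i.e. whose height tends to `+∞` along one of its ends. -/
def IsVerticalGeodesicLine (w : H) (aRep : ℝ → H) (V : ℝ → H) : Prop :=
  IsGeodesicLine V ∧
    (Tendsto (fun t => height w aRep (V t)) atTop atTop ∨
     Tendsto (fun t => height w aRep (V t)) atBot atTop)

/-- A vertical geodesic parametrised by its height: `h(V(t)) = t` for all `t`. -/
def VertParam (w : H) (aRep : ℝ → H) (V : ℝ → H) : Prop :=
  IsGeodesicLine V ∧ ∀ t : ℝ, height w aRep (V t) = t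

/-- Height difference `Δh(x,y)`. -/
def dh (w : H) (aRep : ℝ → H) (x y : H) : ℝ :=
  |height w aRep x - height w aRep y|

/-- Relative distance `d_r(x,y) = d(x,y) - Δh(x,y)`. -/
def dr (w : H) (aRep : ℝ → H) (x y : H) : ℝ := dist x y - dh w aRep x y

/-- Maximal height `h⁺` of a path along the parameter set `I`. -/
def hplusOn (w : H) (aRep : ℝ → H) (γ : ℝ → H) (I : Set ℝ) : ℝ :=
  sSup ((fun t => height w aRep (γ t)) '' I)

/-- Minimal height `h⁻` of a path along the parameter set `I`. -/
def hminusOn (w : H) (aRep : ℝ → H) (γ : ℝ → H) (I : Set ℝ) : ℝ :=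
  sInf ((fun t => height w aRep (γ t)) '' I)

/-- A path parametrised by arclength: the length of the piece on `[s,t]` equals `t - s`. -/
def ArclengthPath (V : ℝ → H) : Prop :=
  ∀ s t : ℝ, s ≤ t → eVariationOn V (Set.Icc s t) = ENNReal.ofReal (t - s)

/-- An admissible norm on `ℝ²`: a norm with `N(1,1) = 1` and `N(a,b) ≥ (a+b)/2`. -/
structure AdmNorm where
  toFun : ℝ × ℝ → ℝ
  eq_zero_iff : ∀ v : ℝ × ℝ, toFun v = 0 ↔ v = 0
  smul_eq : ∀ (c : ℝ) (v : ℝ × ℝ), toFun (c • v) = |c| * toFun v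
  add_le : ∀ v w : ℝ × ℝ, toFun (v + w) ≤ toFun v + toFun w
  one_one : toFun (1, 1) = 1
  adm : ∀ a b : ℝ, (a + b) / 2 ≤ toFun (a, b)

/-- `C` is a comparison constant `C_N` for the admissible norm `N`:
`C ≥ 1` and `N(a,b) ≤ C(a+b)/2` for all `a,b ≥ 0`. -/
def AdmNorm.BoundConst (N : AdmNorm) (C : ℝ) : Prop :=
  1 ≤ C ∧ ∀ a b : ℝ, 0 ≤ a → 0 ≤ b → N.toFun (a, b) ≤ C * (a + b) / 2

variable {Hp Hq : Type*} [MetricSpace Hp] [MetricSpace Hq]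

/-- Membership in the horospherical product: `h_p(x_p) + h_q(x_q) = 0`. -/
def inHoro (wp : Hp) (ap : ℝ → Hp) (wq : Hq) (aq : ℝ → Hq) (z : Hp × Hq) : Prop :=
  height wp ap z.1 + height wq aq z.2 = 0

/-- The `N`-length of a path in `Hp × Hq`: supremum over finite monotone
subdivisions of the sums of the `N(d_p, d_q)`-distances. -/
def lN (Nf : ℝ × ℝ → ℝ) (γ : ℝ → Hp × Hq) (s : Set ℝ) : ℝ≥0∞ :=
  ⨆ p : ℕ × { u : ℕ → ℝ // Monotone u ∧ ∀ i, u i ∈ s },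
    ∑ i ∈ Finset.range p.1,
      ENNReal.ofReal (Nf (dist (γ (p.2.1 (i+1))).1 (γ (p.2.1 i)).1,
                          dist (γ (p.2.1 (i+1))).2 (γ (p.2.1 i)).2))

/-- The `N`-path metric: infimum of `N`-lengths of connected paths staying in the
horospherical product and joining the two points. -/
def dHN (Nf : ℝ × ℝ → ℝ) (mem : Hp × Hq → Prop) (x y : Hp × Hq) : ℝ≥0∞ :=
  ⨅ (T : ℝ) (_ : 0 ≤ T) (γ : ℝ → Hp × Hq) (_ : ContinuousOn γ (Set.Icc 0 T))
    (_ : ∀ t ∈ Set.Icc (0:ℝ) T, mem (γ t)) (_ : γ 0 = x) (_ : γ T = y),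
    lN Nf γ (Set.Icc 0 T)

/-- A geodesic of the horospherical product with respect to the `N`-path metric,
parametrised (by arclength) on `I` and staying in the product. -/
def IsHNGeodesicOn (Nf : ℝ × ℝ → ℝ) (mem : Hp × Hq → Prop)
    (α : ℝ → Hp × Hq) (I : Set ℝ) : Prop :=
  (∀ t ∈ I, mem (α t)) ∧
  ∀ s ∈ I, ∀ t ∈ I, dHN Nf mem (α s) (α t) = ENNReal.ofReal |s - t|

/-- A vertical geodesic of the horospherical product, parametrised by its height. -/
def IsHNVerticalLine (Nf : ℝ × ℝ → ℝ) (mem : Hp × Hq → Prop)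
    (wp : Hp) (ap : ℝ → Hp) (V : ℝ → Hp × Hq) : Prop :=
  IsHNGeodesicOn Nf mem V Set.univ ∧ ∀ t : ℝ, height wp ap (V t).1 = t

/-- Maximal height `h⁺` of a path of the horospherical product. -/
def hplusH (wp : Hp) (ap : ℝ → Hp) (γ : ℝ → Hp × Hq) (I : Set ℝ) : ℝ :=
  sSup ((fun t => height wp ap (γ t).1) '' I)

/-- Minimal height `h⁻` of a path of the horospherical product. -/
def hminusH (wp : Hp) (ap : ℝ → Hp) (γ : ℝ → Hp × Hq) (I : Set ℝ) : ℝ :=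
  sInf ((fun t => height wp ap (γ t).1) '' I)

/-- `H_p`-type path at scale `κ`: the first component stays `κ`-close to a geodesic
of `H_p` and the second component stays `κ`-close to a vertical geodesic of `H_q`. -/
def IsHpType (wq : Hq) (aq : ℝ → Hq) (κ : ℝ) (α : ℝ → Hp × Hq) : Prop :=
  (∃ g : ℝ → Hp, IsGeodesicLine g ∧ ∀ t : ℝ, ∃ s : ℝ, dist (α t).1 (g s) ≤ κ) ∧
  (∃ v : ℝ → Hq, IsVerticalGeodesicLine wq aq v ∧ ∀ t : ℝ, ∃ s : ℝ, dist (α t).2 (v s) ≤ κ)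

/-- `H_q`-type path at scale `κ`. -/
def IsHqType (wp : Hp) (ap : ℝ → Hp) (κ : ℝ) (α : ℝ → Hp × Hq) : Prop :=
  (∃ g : ℝ → Hq, IsGeodesicLine g ∧ ∀ t : ℝ, ∃ s : ℝ, dist (α t).2 (g s) ≤ κ) ∧
  (∃ v : ℝ → Hp, IsVerticalGeodesicLine wp ap v ∧ ∀ t : ℝ, ∃ s : ℝ, dist (α t).1 (v s) ≤ κ)

/-- Finite Hausdorff distance on `[0,∞)` between two rays, for a generalized
(`ℝ≥0∞`-valued) distance `dd`. -/
def HNFinHaus {X : Type*} (dd : X → X → ℝ≥0∞) (α β : ℝ → X) : Prop :=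
  ∃ C : ℝ, (∀ s : ℝ, 0 ≤ s → ∃ t : ℝ, 0 ≤ t ∧ dd (α s) (β t) ≤ ENNReal.ofReal C) ∧
           (∀ t : ℝ, 0 ≤ t → ∃ s : ℝ, 0 ≤ s ∧ dd (α s) (β t) ≤ ENNReal.ofReal C)

theorem finHaus_equivalence (H : Type*) [MetricSpace H] :
    Equivalence (fun γ₁ γ₂ : {γ : ℝ → H // IsGeodesicRay γ} => FinHausRays γ₁.1 γ₂.1) := by
  constructor
  · intro γ
    exact ⟨0, fun s hs => ⟨s, hs, by simp⟩, fun t ht => ⟨t, ht, by simp⟩⟩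
  · rintro γ₁ γ₂ ⟨C, h1, h2⟩
    refine ⟨C, fun s hs => ?_, fun t ht => ?_⟩
    · obtain ⟨u, hu, hd⟩ := h2 s hs
      exact ⟨u, hu, by rwa [dist_comm]⟩
    · obtain ⟨u, hu, hd⟩ := h1 t ht
      exact ⟨u, hu, by rwa [dist_comm]⟩
  · rintro γ₁ γ₂ γ₃ ⟨C, h1, h2⟩ ⟨D, g1, g2⟩
    refine ⟨C + D, fun s hs => ?_, fun t ht => ?_⟩
    · obtain ⟨u, hu, hd⟩ := h1 s hs
      obtain ⟨v, hv, he⟩ := g1 u hu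
      exact ⟨v, hv, (dist_triangle _ (γ₂.1 u) _).trans (add_le_add hd he)⟩
    · obtain ⟨u, hu, hd⟩ := g2 t ht
      obtain ⟨v, hv, he⟩ := h2 u hu
      exact ⟨v, hv, (dist_triangle _ (γ₂.1 u) _).trans (add_le_add he hd)⟩

/-- The setoid of geodesic rays up to finite Hausdorff distance. -/
instance raySetoid (H : Type*) [MetricSpace H] : Setoid {γ : ℝ → H // IsGeodesicRay γ} :=
  ⟨fun γ₁ γ₂ => FinHausRays γ₁.1 γ₂.1, finHaus_equivalence H⟩

/-- The Gromov boundary: equivalence classes of geodesic rays at finite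
Hausdorff distance. -/
abbrev Bdry (H : Type*) [MetricSpace H] := Quotient (raySetoid H)

/-- The boundary point determined by a geodesic ray. -/
def bdryPt {H : Type*} [MetricSpace H] (γ : ℝ → H) (h : IsGeodesicRay γ) : Bdry H :=
  Quotient.mk (raySetoid H) ⟨γ, h⟩

/-- The set `((∂H_p ∖ {a_p}) × {a_q}) ∪ ({a_p} × (∂H_q ∖ {a_q}))`. -/
def bdryTarget {Hp Hq : Type*} [MetricSpace Hp] [MetricSpace Hq]
    (ap : ℝ → Hp) (hap : IsGeodesicRay ap)
    (aq : ℝ → Hq) (haq : IsGeodesicRay aq) : Set (Bdry Hp × Bdry Hq) :=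
  ((({bdryPt ap hap} : Set (Bdry Hp))ᶜ ×ˢ ({bdryPt aq haq} : Set (Bdry Hq))) ∪
   (({bdryPt ap hap} : Set (Bdry Hp)) ×ˢ ({bdryPt aq haq} : Set (Bdry Hq))ᶜ))

theorem eq_of_finHausRays (hB : BusemannSpace H) {w : H} {a k : ℝ → H}
    (ha : IsRayFrom w a) (hk : IsRayFrom w k) (hak : FinHausRays a k) {T : ℝ} (hT : 0 ≤ T) :
    k T = a T := by
  obtain ⟨C, hC, -⟩ := hak
  have hbound : ∀ R, 0 ≤ R → dist (a R) (k R) ≤ 2 * C := by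
    intro R hR
    obtain ⟨t, ht, h1⟩ := hC R hR
    have h2 := ha.1 R hR 0 (mem_Ici.2 le_rfl)
    have h3 := hk.1 t ht 0 (mem_Ici.2 le_rfl)
    rw [ha.2, sub_zero, abs_of_nonneg hR] at h2
    rw [hk.2, sub_zero, abs_of_nonneg ht] at h3
    have h4 := hk.1 t ht R hR
    have h5 : |t - R| ≤ C := by
      rw [abs_le]
      have h6 := dist_triangle (a R) (k t) w
      have h7 := dist_triangle (k t) (a R) w
      rw [dist_comm (k t) (a R)] at h7
      constructor <;> linarith
    linarith [dist_triangle (a R) (k t) (k R)]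
  have hconv : ∀ R, T ≤ R → R * dist (a T) (k T) ≤ 2 * C * T := by
    intro R hTR
    have hR : 0 ≤ R := hT.trans hTR
    rcases hR.eq_or_lt with h0 | hRpos
    · have : T = 0 := by linarith
      subst this
      rw [← h0]; simp
    have hf := hB.2 0 R 0 R a k (fun s hs t ht => ha.1 s hs.1 t ht.1)
      (fun s hs t ht => hk.1 s hs.1 t ht.1)
    have hm0 : ((0, 0) : ℝ × ℝ) ∈ Icc (0 : ℝ) R ×ˢ Icc (0 : ℝ) R := ⟨⟨le_rfl, hR⟩, ⟨le_rfl, hR⟩⟩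
    have hmR : ((R, R) : ℝ × ℝ) ∈ Icc (0 : ℝ) R ×ˢ Icc (0 : ℝ) R := ⟨⟨hR, le_rfl⟩, ⟨hR, le_rfl⟩⟩
    have hTR1 : 0 ≤ 1 - T / R := by rw [sub_nonneg]; exact (div_le_one hRpos).2 hTR
    have hTR2 : 0 ≤ T / R := by positivity
    have hc := hf.2 hm0 hmR hTR1 hTR2 (by ring)
    have e1 : T / R * R = T := div_mul_cancel₀ _ hRpos.ne'
    simp only [Prod.smul_mk, smul_eq_mul, mul_zero, Prod.mk_add_mk, zero_add, ha.2, hk.2,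
      dist_self, e1] at hc
    have h1 := hbound R hR
    calc R * dist (a T) (k T) ≤ R * (T / R * dist (a R) (k R)) := by gcongr
      _ = T * dist (a R) (k R) := by field_simp
      _ ≤ 2 * C * T := by nlinarith
  by_contra hne
  have hpos : 0 < dist (a T) (k T) := dist_pos.2 (fun h => hne h.symm)
  have hC0 : 0 ≤ C := by linarith [hbound 0 le_rfl, dist_nonneg (x := a 0) (y := k 0)]
  have := hconv (T + (2 * C * T + 1) / dist (a T) (k T)) (by
    have : 0 ≤ (2 * C * T + 1) / dist (a T) (k T) := by positivity
    linarith)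
  rw [add_mul, div_mul_cancel₀ _ hpos.ne'] at this
  nlinarith

theorem antitone_dist_ray_sub {w : H} {a : ℝ → H} (ha : IsRayFrom w a) (x : H) :
    Antitone fun t : ℝ => dist x (a (max t 0)) - max t 0 := by
  intro s t hst
  have h1 : max s 0 ≤ max t 0 := max_le_max hst le_rfl
  have h2 := ha.1 (max t 0) (mem_Ici.2 (le_max_right _ _)) (max s 0) (mem_Ici.2 (le_max_right _ _))
  rw [abs_of_nonneg (sub_nonneg.2 h1)] at h2
  have h3 := dist_triangle x (a (max s 0)) (a (max t 0))
  rw [dist_comm (a (max s 0))] at h3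
  simp only
  linarith

theorem tendsto_busemann (hB : BusemannSpace H) {w : H} {a : ℝ → H} (ha : IsRayFrom w a) (x : H) :
    Tendsto (fun t => dist x (a t) - t) atTop (nhds (busemann w a x)) := by
  have hbdd : BddBelow (range fun t : ℝ => dist x (a (max t 0)) - max t 0) := by
    refine ⟨-dist x w, ?_⟩
    rintro _ ⟨t, rfl⟩
    have h2 := ha.1 (max t 0) (mem_Ici.2 (le_max_right _ _)) 0 (mem_Ici.2 le_rfl)
    rw [ha.2, sub_zero, abs_of_nonneg (le_max_right _ _), dist_comm] at h2
    have := dist_triangle w x (a (max t 0))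
    rw [dist_comm w x] at this
    simp only
    linarith
  have hlim := tendsto_atTop_ciInf (antitone_dist_ray_sub ha x) hbdd
  have hlim' : Tendsto (fun t => dist x (a t) - t) atTop
      (nhds (⨅ t : ℝ, (dist x (a (max t 0)) - max t 0))) := by
    refine hlim.congr' ?_
    filter_upwards [eventually_ge_atTop 0] with t ht
    rw [max_eq_left ht]
  convert hlim' using 2
  have hset : { b : ℝ | ∃ k : ℝ → H, IsRayFrom w k ∧ FinHausRays a k ∧
      b = Filter.limsup (fun t => dist x (k t) - t) Filter.atTop } =
      {⨅ t : ℝ, (dist x (a (max t 0)) - max t 0)} := by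
    ext b
    simp only [mem_ofPred_eq, mem_singleton_iff]
    constructor
    · rintro ⟨k, hk, hak, rfl⟩
      refine Tendsto.limsup_eq (hlim'.congr' ?_)
      filter_upwards [eventually_ge_atTop 0] with t ht
      rw [eq_of_finHausRays hB ha hk hak ht]
    · rintro rfl
      exact ⟨a, ha, ⟨0, fun s hs => ⟨s, hs, by simp⟩, fun t ht => ⟨t, ht, by simp⟩⟩,
        hlim'.limsup_eq.symm⟩
  rw [busemann, hset, csSup_singleton]

theorem busemann_le_dist_sub (hB : BusemannSpace H) {w : H} {a : ℝ → H} (ha : IsRayFrom w a)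
    (x : H) {t : ℝ} (ht : 0 ≤ t) : busemann w a x ≤ dist x (a t) - t := by
  refine le_of_tendsto (tendsto_busemann hB ha x) ?_
  filter_upwards [eventually_ge_atTop t] with s hs
  have := antitone_dist_ray_sub ha x hs
  simpa [max_eq_left ht, max_eq_left (ht.trans hs)] using this

theorem abs_height_sub_le (hB : BusemannSpace H) {w : H} {a : ℝ → H} (ha : IsRayFrom w a)
    (x y : H) : |height w a x - height w a y| ≤ dist x y := by
  have key : ∀ x y, busemann w a x - busemann w a y ≤ dist x y := by
    intro x y
    refine le_of_tendsto ((tendsto_busemann hB ha x).sub (tendsto_busemann hB ha y))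
      (Eventually.of_forall fun t => ?_)
    linarith [dist_triangle x y (a t)]
  have h1 := key x y
  have h2 := key y x
  rw [dist_comm] at h2
  simp only [height]
  rw [abs_le]
  constructor <;> linarith

theorem exists_tendsto_ultrafilter_of_dist_le [ProperSpace H] (U : Ultrafilter ℕ) (u : ℕ → H)
    (x : H) (R : ℝ) (h : ∀ n, dist (u n) x ≤ R) : ∃ y, Tendsto u U (nhds y) := by
  obtain ⟨y, -, hy⟩ := (isCompact_closedBall x R).ultrafilter_le_nhds (U.map u) (by
    rw [le_principal_iff]
    exact mem_map.2 (univ_mem' h))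
  exact ⟨y, hy⟩

theorem exists_tendsto_ultrafilter_of_mem_Icc (U : Ultrafilter ℕ) (u : ℕ → ℝ) (a b : ℝ)
    (h : ∀ n, u n ∈ Icc a b) : ∃ y ∈ Icc a b, Tendsto u U (nhds y) := by
  obtain ⟨y, hy, hy'⟩ := (isCompact_Icc (a := a) (b := b)).ultrafilter_le_nhds (U.map u) (by
    rw [le_principal_iff]
    exact mem_map.2 (univ_mem' h))
  exact ⟨y, hy, hy'⟩

/-- A height function `h` together with a choice of an upward vertical line `V x` through every
point `x`, such that the vertical lines through the endpoints of a geodesic segment both pass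
near a common point of that segment. -/
structure VertSys (δ : ℝ) (h : H → ℝ) (V : H → ℝ → H) : Prop where
  lip : ∀ a b, |h a - h b| ≤ dist a b
  zero : ∀ x, V x 0 = x
  isom : ∀ x s t, dist (V x s) (V x t) = |s - t|
  height : ∀ x t, h (V x t) = h x + t
  tripod : ∀ c x y, IsGeodSegment c x y → ∃ r ∈ Icc 0 (dist x y), ∃ s t : ℝ, 0 ≤ s ∧ 0 ≤ t ∧
    dist (c r) (V x s) ≤ δ ∧ dist (c r) (V y t) ≤ δ

theorem GeodesicallyComplete.exists_line (hG : GeodesicallyComplete H) (hS : GeodesicSpace H)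
    (x y : H) : ∃ γ : ℝ → H, IsGeodesicLine γ ∧ γ 0 = x ∧ γ (dist x y) = y := by
  obtain ⟨c, hc, h0, h1⟩ := hS x y
  obtain ⟨γ, hγ, he⟩ := hG 0 (dist x y) c dist_nonneg hc
  exact ⟨γ, hγ, by rw [he 0 ⟨le_rfl, dist_nonneg⟩, h0],
    by rw [he _ ⟨dist_nonneg, le_rfl⟩, h1]⟩

theorem BusemannSpace.convexOn_dist_point (hB : BusemannSpace H) {γ : ℝ → H}
    (hγ : IsGeodesicLine γ) (p : H) : ConvexOn ℝ univ fun t => dist (γ t) p := by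
  refine ⟨convex_univ, ?_⟩
  intro s _ t _ u v hu hv huv
  have hf := hB.2 (min s t) (max s t) 0 0 γ (fun _ => p)
    (fun s _ t _ => hγ s (mem_univ _) t (mem_univ _)) (by
      rintro s ⟨hs, hs'⟩ t ⟨ht, ht'⟩
      have h1 : s = 0 := le_antisymm hs' hs
      have h2 : t = 0 := le_antisymm ht' ht
      simp [h1, h2])
  have h1 : ((s, 0) : ℝ × ℝ) ∈ Icc (min s t) (max s t) ×ˢ Icc (0 : ℝ) 0 :=
    ⟨⟨min_le_left _ _, le_max_left _ _⟩, ⟨le_rfl, le_rfl⟩⟩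
  have h2 : ((t, 0) : ℝ × ℝ) ∈ Icc (min s t) (max s t) ×ˢ Icc (0 : ℝ) 0 :=
    ⟨⟨min_le_right _ _, le_max_right _ _⟩, ⟨le_rfl, le_rfl⟩⟩
  exact hf.2 h1 h2 hu hv huv

theorem DeltaHyperbolic.exists_common_near {δ : ℝ} (hH : DeltaHyperbolic H δ) (hδ : 0 ≤ δ)
    {x y z : H} {c gx gy : ℝ → H} (hc : IsGeodSegment c x y) (hgx : IsGeodesicLine gx)
    (hgx0 : gx 0 = x) (hgx1 : gx (dist x z) = z) (hgy : IsGeodesicLine gy)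
    (hgy0 : gy 0 = y) (hgy1 : gy (dist y z) = z) :
    ∃ r ∈ Icc 0 (dist x y), ∃ s ∈ Icc 0 (dist x y + δ), ∃ t ∈ Icc 0 (dist x y + δ),
      dist (c r) (gx s) ≤ δ ∧ dist (c r) (gy t) ≤ δ := by
  have hcont : ∀ γ : ℝ → H, IsGeodesicLine γ → Continuous γ := fun γ hγ =>
    (LipschitzWith.of_dist_le_mul (K := 1) fun s t => by
      rw [hγ s (mem_univ _) t (mem_univ _), Real.dist_eq]; simp).continuous
  set D := dist x y with hD
  have hD0 : 0 ≤ D := dist_nonneg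
  let e : ℝ → H := fun r => c (projIcc 0 D hD0 r)
  have he : ∀ r ∈ Icc 0 D, e r = c r := fun r hr => by simp [e, projIcc_of_mem hD0 hr]
  have hecont : Continuous e := by
    have : LipschitzWith 1 (fun r : Icc 0 D => c r) := LipschitzWith.of_dist_le_mul fun s t => by
      rw [hc.1 s s.2 t t.2, Subtype.dist_eq, Real.dist_eq]; simp
    exact this.continuous.comp continuous_projIcc
  set Kx := gx '' Icc 0 (dist x z) with hKx
  set Ky := gy '' Icc 0 (dist y z) with hKy
  have hxK : x ∈ Kx := ⟨0, ⟨le_rfl, dist_nonneg⟩, hgx0⟩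
  have hyK : y ∈ Ky := ⟨0, ⟨le_rfl, dist_nonneg⟩, hgy0⟩
  have hKxc : IsCompact Kx := isCompact_Icc.image (hcont _ hgx)
  have hKyc : IsCompact Ky := isCompact_Icc.image (hcont _ hgy)
  have hA : IsClosed {r | Metric.infDist (e r) Kx ≤ δ} :=
    isClosed_le ((Metric.continuous_infDist_pt _).comp hecont) continuous_const
  have hB : IsClosed {r | Metric.infDist (e r) Ky ≤ δ} :=
    isClosed_le ((Metric.continuous_infDist_pt _).comp hecont) continuous_const
  have hcover : Icc 0 D ⊆ {r | Metric.infDist (e r) Kx ≤ δ} ∪ {r | Metric.infDist (e r) Ky ≤ δ} := by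
    intro r hr
    have hy' : IsGeodSegment gy y z :=
      ⟨fun s _ t _ => hgy s (mem_univ _) t (mem_univ _), hgy0, hgy1⟩
    have hx' : IsGeodSegment (fun t => gx (dist z x - t)) z x := by
      refine ⟨fun s _ t _ => ?_, ?_, ?_⟩
      · rw [hgx _ (mem_univ _) _ (mem_univ _), abs_sub_comm]
        congr 1; ring
      · simp [dist_comm z x, hgx1]
      · simp [hgx0]
    obtain ⟨u, hu, hd⟩ := hH.2 x y z c gy _ hc hy' hx' r hr
    rcases hu with hu | ⟨t, ht, rfl⟩
    · right
      simp only [mem_ofPred_eq, he r hr]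
      exact (Metric.infDist_le_dist_of_mem hu).trans hd
    · left
      simp only [mem_ofPred_eq, he r hr]
      refine (Metric.infDist_le_dist_of_mem ?_).trans hd
      refine ⟨dist z x - t, ⟨by linarith [ht.2], ?_⟩, rfl⟩
      rw [dist_comm x z]
      linarith [ht.1]
  obtain ⟨r, hr, hrA, hrB⟩ := isPreconnected_closed_iff.1 (isPreconnected_Icc (a := 0) (b := D))
    _ _ hA hB hcover
    ⟨0, ⟨le_rfl, hD0⟩, by
      simp only [mem_ofPred_eq, he 0 ⟨le_rfl, hD0⟩, hc.2.1, Metric.infDist_zero_of_mem hxK, hδ]⟩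
    ⟨D, ⟨hD0, le_rfl⟩, by
      have heD : e D = y := (he D ⟨hD0, le_rfl⟩).trans hc.2.2
      simp only [mem_ofPred_eq, heD, Metric.infDist_zero_of_mem hyK, hδ]⟩
  simp only [mem_ofPred_eq, he r hr] at hrA hrB
  obtain ⟨_, ⟨s, hs, rfl⟩, hs'⟩ := hKxc.exists_infDist_eq_dist ⟨x, hxK⟩ (c r)
  obtain ⟨_, ⟨t, ht, rfl⟩, ht'⟩ := hKyc.exists_infDist_eq_dist ⟨y, hyK⟩ (c r)
  have hcx : dist x (c r) = r := by
    rw [← hc.2.1, hc.1 0 ⟨le_rfl, hD0⟩ r hr, zero_sub, abs_neg, abs_of_nonneg hr.1]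
  have hcy : dist y (c r) = D - r := by
    rw [← hc.2.2, hc.1 _ ⟨hD0, le_rfl⟩ r hr, abs_of_nonneg (by linarith [hr.2])]
  have hsx : dist x (gx s) = s := by
    rw [← hgx0, hgx _ (mem_univ _) _ (mem_univ _), zero_sub, abs_neg, abs_of_nonneg hs.1]
  have hty : dist y (gy t) = t := by
    rw [← hgy0, hgy _ (mem_univ _) _ (mem_univ _), zero_sub, abs_neg, abs_of_nonneg ht.1]
  rw [hs'] at hrA
  rw [ht'] at hrB
  refine ⟨r, hr, s, ⟨hs.1, ?_⟩, t, ⟨ht.1, ?_⟩, hrA, hrB⟩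
  · linarith [dist_triangle x (c r) (gx s), hr.2]
  · linarith [dist_triangle y (c r) (gy t), hr.1]

theorem exists_vertSys [ProperSpace H] {δ : ℝ} (hδ : 0 ≤ δ) (hH : DeltaHyperbolic H δ)
    (hB : BusemannSpace H) (hG : GeodesicallyComplete H) {w : H} {a : ℝ → H}
    (ha : IsRayFrom w a) : ∃ V : H → ℝ → H, VertSys δ (height w a) V := by
  choose g hg hg0 hg1 using fun (x : H) (n : ℕ) => hG.exists_line hH.1 x (a n)
  let U : Ultrafilter ℕ := hyperfilter ℕ
  have hU : (U : Filter ℕ) ≤ atTop := Nat.hyperfilter_le_atTop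
  have hgd : ∀ x n s t, dist (g x n s) (g x n t) = |s - t| := fun x n s t =>
    hg x n s (mem_univ _) t (mem_univ _)
  choose V hV using fun (x : H) (t : ℝ) => exists_tendsto_ultrafilter_of_dist_le U
    (fun n => g x n t) x |t| (fun n => by
      have := hgd x n t 0
      rw [hg0, sub_zero] at this
      exact this.le)
  have hzero : ∀ x, V x 0 = x := fun x =>
    tendsto_nhds_unique (hV x 0) (by simp only [hg0]; exact tendsto_const_nhds)
  have hisom : ∀ x s t, dist (V x s) (V x t) = |s - t| := fun x s t =>
    tendsto_nhds_unique ((hV x s).dist (hV x t)) (by simp only [hgd]; exact tendsto_const_nhds)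
  have hline : ∀ x, IsGeodesicLine (V x) := fun x s _ t _ => hisom x s t
  set b := busemann w a with hb
  have hlip : ∀ x y, b x ≤ b y + dist x y := fun x y => by
    have := (abs_le.1 (abs_height_sub_le hB ha x y)).1
    simp only [height] at this
    linarith
  have hray : ∀ x, Tendsto (fun n : ℕ => dist x (a n) - n) U (nhds (b x)) := fun x =>
    ((tendsto_busemann hB ha x).comp tendsto_natCast_atTop_atTop).mono_left hU
  have hle : ∀ x t, b (V x t) ≤ b x - t := by
    intro x t
    have h1 : Tendsto (fun n : ℕ => dist x (a n) - n - t + dist (V x t) (g x n t)) U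
        (nhds (b x - t + 0)) := by
      refine ((hray x).sub_const t).add ?_
      have := (tendsto_const_nhds (x := V x t)).dist (hV x t)
      rwa [dist_self] at this
    rw [add_zero] at h1
    refine ge_of_tendsto h1 ?_
    have h2 : ∀ᶠ n : ℕ in U, t ≤ dist x (a n) := by
      have h3 := (hray x).eventually (eventually_gt_nhds (show b x - 1 < b x by linarith))
      have h4 : ∀ᶠ n : ℕ in U, t - (b x - 1) ≤ n :=
        (tendsto_natCast_atTop_atTop.eventually (eventually_ge_atTop _)).filter_mono hU
      filter_upwards [h3, h4] with n h5 h6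
      linarith
    filter_upwards [h2] with n hn
    have h3 := busemann_le_dist_sub hB ha (g x n t) n.cast_nonneg
    have h4 := hgd x n t (dist x (a n))
    rw [hg1, abs_sub_comm, abs_of_nonneg (by linarith)] at h4
    linarith [hlip (V x t) (g x n t)]
  have hge0 : ∀ x t, 0 ≤ t → b x - t ≤ b (V x t) := by
    intro x t ht
    have h1 := hlip x (V x t)
    have h2 := hisom x 0 t
    rw [hzero, zero_sub, abs_neg, abs_of_nonneg ht] at h2
    linarith
  have hconv : ∀ x, ConvexOn ℝ univ fun t => b (V x t) := by
    intro x
    refine ⟨convex_univ, ?_⟩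
    intro s _ t _ u v hu hv huv
    refine le_of_tendsto_of_tendsto (tendsto_busemann hB ha _)
      (((tendsto_busemann hB ha (V x s)).const_mul u).add
        ((tendsto_busemann hB ha (V x t)).const_mul v)) (Eventually.of_forall fun T => ?_)
    have := (hB.convexOn_dist_point (hline x) (a T)).2 (mem_univ s) (mem_univ t) hu hv huv
    simp only [smul_eq_mul] at this ⊢
    have e : u * (dist (V x s) (a T) - T) + v * (dist (V x t) (a T) - T) =
      u * dist (V x s) (a T) + v * dist (V x t) (a T) - (u + v) * T := by ring
    rw [e, huv, one_mul]
    linarith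
  have hge : ∀ x t, b x - t ≤ b (V x t) := by
    intro x t
    rcases le_or_gt 0 t with ht | ht
    · exact hge0 x t ht
    have hp : 0 < 1 - t := by linarith
    have hu : 0 ≤ 1 / (1 - t) := by positivity
    have hv : 0 ≤ -t / (1 - t) := div_nonneg (by linarith) hp.le
    have := (hconv x).2 (mem_univ t) (mem_univ 1) hu hv (by field_simp; ring)
    simp only [smul_eq_mul] at this
    have e : 1 / (1 - t) * t + -t / (1 - t) * 1 = 0 := by field_simp; ring
    rw [e, hzero] at this
    have h1 := hle x 1
    have h2 : b x * (1 - t) ≤ b (V x t) + -t * b (V x 1) := by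
      calc b x * (1 - t) ≤ (1 / (1 - t) * b (V x t) + -t / (1 - t) * b (V x 1)) * (1 - t) := by
            gcongr
        _ = b (V x t) + -t * b (V x 1) := by field_simp
    nlinarith
  refine ⟨V, abs_height_sub_le hB ha, hzero, hisom, fun x t => ?_, fun c x y hc => ?_⟩
  · have := le_antisymm (hle x t) (hge x t)
    simp only [height]
    linarith
  · choose r hr s hs t ht h1 h2 using fun n : ℕ => hH.exists_common_near hδ hc (hg x n) (hg0 x n)
      (hg1 x n) (hg y n) (hg0 y n) (hg1 y n)
    obtain ⟨r', hr', hrl⟩ := exists_tendsto_ultrafilter_of_mem_Icc U r _ _ hr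
    obtain ⟨s', hs', hsl⟩ := exists_tendsto_ultrafilter_of_mem_Icc U s _ _ hs
    obtain ⟨t', ht', htl⟩ := exists_tendsto_ultrafilter_of_mem_Icc U t _ _ ht
    have key : ∀ (z : H) (s : ℕ → ℝ) (s' : ℝ), Tendsto s U (nhds s') →
        (∀ n, dist (c (r n)) (g z n (s n)) ≤ δ) → dist (c r') (V z s') ≤ δ := by
      intro z s s' hsl h1
      have hl : Tendsto (fun n => |r' - r n| + δ + (|s n - s'| + dist (g z n s') (V z s'))) U
          (nhds (|r' - r'| + δ + (|s' - s'| + dist (V z s') (V z s')))) :=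
        ((tendsto_const_nhds.sub hrl).abs.add_const δ).add
          ((hsl.sub_const s').abs.add ((hV z s').dist tendsto_const_nhds))
      simp only [sub_self, abs_zero, dist_self, zero_add, add_zero] at hl
      refine ge_of_tendsto' hl fun n => ?_
      have e1 := hc.1 r' hr' (r n) (hr n)
      have e2 := hgd z n (s n) s'
      linarith [dist_triangle4 (c r') (c (r n)) (g z n (s n)) (V z s'), h1 n,
        dist_triangle (g z n (s n)) (g z n s') (V z s')]
    exact ⟨r', hr', s', t', hs'.1, ht'.1, key x s s' hsl h1, key y t t' htl h2⟩

theorem IsGeodSegment.symm {x y : H} {c : ℝ → H} (hc : IsGeodSegment c x y) :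
    IsGeodSegment (fun t => c (dist x y - t)) y x := by
  refine ⟨fun s hs t ht => ?_, by simp [hc.2.2], by simp [dist_comm y x, hc.2.1]⟩
  rw [dist_comm y x] at hs ht
  rw [hc.1 _ ⟨by linarith [hs.2], by linarith [hs.1]⟩ _ ⟨by linarith [ht.2], by linarith [ht.1]⟩,
    abs_sub_comm]
  congr 1; ring

theorem IsGeodSegment.dist_left {x y : H} {c : ℝ → H} (hc : IsGeodSegment c x y) {r : ℝ}
    (hr : r ∈ Icc 0 (dist x y)) : dist x (c r) = r := by
  rw [← hc.2.1, hc.1 0 ⟨le_rfl, dist_nonneg⟩ r hr, zero_sub, abs_neg, abs_of_nonneg hr.1]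

theorem IsGeodSegment.dist_right {x y : H} {c : ℝ → H} (hc : IsGeodSegment c x y) {r : ℝ}
    (hr : r ∈ Icc 0 (dist x y)) : dist y (c r) = dist x y - r := by
  conv_lhs => rw [← hc.2.2]
  rw [hc.1 _ ⟨dist_nonneg, le_rfl⟩ r hr, abs_of_nonneg (by linarith [hr.2])]

section VertSys

variable {δ : ℝ} {h : H → ℝ} {V : H → ℝ → H}

theorem VertSys.dist_self (hV : VertSys δ h V) (x : H) {t : ℝ} (ht : 0 ≤ t) :
    dist x (V x t) = t := by
  have := hV.isom x 0 t
  rwa [hV.zero, zero_sub, abs_neg, abs_of_nonneg ht] at this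

/-- Two vertical lines come close, at a moderate height. -/
theorem VertSys.exists_merge (hV : VertSys δ h V) (hS : GeodesicSpace H) (x y : H) :
    ∃ s t : ℝ, 0 ≤ s ∧ 0 ≤ t ∧ dist (V x s) (V y t) ≤ 2 * δ ∧ s + t ≤ dist x y + 2 * δ := by
  obtain ⟨c, hc⟩ := hS x y
  obtain ⟨r, hr, s, t, hs, ht, h1, h2⟩ := hV.tripod c x y hc
  refine ⟨s, t, hs, ht, ?_, ?_⟩
  · linarith [dist_triangle_left (V x s) (V y t) (c r)]
  · linarith [dist_triangle x (c r) (V x s), dist_triangle y (c r) (V y t), hV.dist_self x hs,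
      hV.dist_self y ht, hc.dist_left hr, hc.dist_right hr]

theorem VertSys.dist_vert_le (hV : VertSys δ h V) (hS : GeodesicSpace H) (x y : H) :
    dist (V x (h y - h x)) y ≤ dist x y - (h y - h x) + 4 * δ := by
  obtain ⟨s, t, hs, ht, hd, hst⟩ := hV.exists_merge hS x y
  have h1 := hV.lip (V x s) (V y t)
  rw [hV.height, hV.height] at h1
  have h2 := abs_le.1 (h1.trans hd)
  have h3 := hV.isom x (h y - h x) s
  have h4 := hV.dist_self y ht
  rw [dist_comm] at h4
  have h5 := dist_triangle4 (V x (h y - h x)) (V x s) (V y t) y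
  have h6 := (abs_le.1 (hV.lip x y)).1
  rcases le_total s (h y - h x) with hsle | hsle
  · rw [abs_of_nonneg (by linarith)] at h3
    linarith [h2.1, h2.2]
  · rw [abs_of_nonpos (by linarith)] at h3
    linarith [h2.1, h2.2]

theorem VertSys.exists_high_point (hV : VertSys δ h V) {x y : H} {c : ℝ → H}
    (hc : IsGeodSegment c x y) :
    ∃ r ∈ Icc 0 (dist x y), (h x + h y + dist x y) / 2 - 2 * δ ≤ h (c r) := by
  obtain ⟨r, hr, s, t, hs, ht, h1, h2⟩ := hV.tripod c x y hc
  refine ⟨r, hr, ?_⟩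
  have h3 := (abs_le.1 ((hV.lip _ _).trans h1)).1
  have h4 := (abs_le.1 ((hV.lip _ _).trans h2)).1
  rw [hV.height] at h3 h4
  have h5 := dist_triangle_right x (c r) (V x s)
  have h6 := dist_triangle_right y (c r) (V y t)
  rw [hV.dist_self x hs, hc.dist_left hr] at h5
  rw [hV.dist_self y ht, hc.dist_right hr] at h6
  linarith

/-- All geodesic segments from `x` to `y` stay below height `K`. -/
def SegBelow (h : H → ℝ) (K : ℝ) (x y : H) : Prop :=
  ∀ c, IsGeodSegment c x y → ∀ r ∈ Icc 0 (dist x y), h (c r) ≤ K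

theorem SegBelow.trans (hH : DeltaHyperbolic H δ) (hlip : ∀ a b, |h a - h b| ≤ dist a b) {K : ℝ}
    {x y z : H} (hxy : SegBelow h K x y) (hyz : SegBelow h K y z) : SegBelow h (K + δ) x z := by
  intro c hc r hr
  obtain ⟨c₁, hc₁⟩ := hH.1 x y
  obtain ⟨c₂, hc₂⟩ := hH.1 y z
  obtain ⟨u, hu, hd⟩ := hH.2 x z y c _ _ hc hc₂.symm hc₁.symm r hr
  have h1 := (abs_le.1 (hlip (c r) u)).2
  have h2 : h u ≤ K := by
    rcases hu with ⟨t, ht, rfl⟩ | ⟨t, ht, rfl⟩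
    · rw [dist_comm] at ht
      exact hyz c₂ hc₂ _ ⟨by linarith [ht.2], by linarith [ht.1]⟩
    · rw [dist_comm] at ht
      exact hxy c₁ hc₁ _ ⟨by linarith [ht.2], by linarith [ht.1]⟩
  linarith

theorem segBelow_of_dist_le (hlip : ∀ a b, |h a - h b| ≤ dist a b) {K ℓ : ℝ}
    {x y : H} (hx : h x + ℓ ≤ K) (hℓ : dist x y ≤ ℓ) : SegBelow h K x y := by
  intro c hc r hr
  have h1 := (abs_le.1 (hlip x (c r))).1
  rw [hc.dist_left hr] at h1
  linarith [hr.2]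

/-- A discrete path with few high points forces the geodesic segment to be low. -/
theorem segBelow_of_sum_le (hδ : 0 < δ) (hH : DeltaHyperbolic H δ)
    (hlip : ∀ a b, |h a - h b| ≤ dist a b) (z : ℕ → H) :
    ∀ (n a b : ℕ), b - a ≤ n → a < b → ∀ M : ℝ,
      (∀ i, a ≤ i → i < b → dist (z i) (z (i + 1)) ≤ 2) →
      ∑ i ∈ Finset.Ico a b, (2 : ℝ) ^ ((h (z i) - M) / (2 * δ)) ≤ 1 →
      SegBelow h (M + 2 + 2 * δ) (z a) (z b) := by
  intro n
  induction n with
  | zero => intro a b h1 h2; omega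
  | succ n ih =>
    intro a b hn hab M hz hsum
    set F : ℕ → ℝ := fun i => (2 : ℝ) ^ ((h (z i) - M) / (2 * δ)) with hF
    have hFpos : ∀ i, 0 < F i := fun i => Real.rpow_pos_of_pos two_pos _
    have hFM : ∀ i, a ≤ i → i < b → h (z i) ≤ M := by
      intro i hai hib
      have h1 : F i ≤ 1 := (Finset.single_le_sum (f := F) (fun j _ => (hFpos j).le)
        (Finset.mem_Ico.2 ⟨hai, hib⟩)).trans hsum
      by_contra! hlt
      have : 1 < F i := Real.one_lt_rpow one_lt_two (div_pos (by linarith) (by linarith))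
      linarith
    obtain ⟨j, haj, hjb, hj1, hj2⟩ : ∃ j, a ≤ j ∧ j < b ∧ ∑ i ∈ Finset.Ico a j, F i ≤ 1 / 2 ∧
        ∑ i ∈ Finset.Ico (j + 1) b, F i ≤ 1 / 2 := by
      by_contra! hno
      have : ∀ k, a + k < b → ∑ i ∈ Finset.Ico a (a + k), F i ≤ 1 / 2 := by
        intro k
        induction k with
        | zero => intro _; simp
        | succ k ihk =>
          intro hk
          have h1 := hno (a + k) (by omega) (by omega) (ihk (by omega))
          have h2 := Finset.sum_Ico_consecutive F (show a ≤ a + k + 1 by omega)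
            (show a + k + 1 ≤ b by omega)
          rw [← add_assoc]
          linarith
      have h1 := hno (b - 1) (by omega) (by omega) (by
        have := this (b - 1 - a) (by omega)
        rwa [show a + (b - 1 - a) = b - 1 by omega] at this)
      rw [show b - 1 + 1 = b by omega] at h1
      simp only [Finset.Ico_self, Finset.sum_empty] at h1
      linarith
    have hshift : ∀ i, (2 : ℝ) ^ ((h (z i) - (M - 2 * δ)) / (2 * δ)) = 2 * F i := by
      intro i
      have e : (h (z i) - (M - 2 * δ)) / (2 * δ) = 1 + (h (z i) - M) / (2 * δ) := by
        field_simp; ring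
      rw [e, Real.rpow_add two_pos, Real.rpow_one]
    have hsub : ∀ a' b', a ≤ a' → b' ≤ b → b' - a' ≤ n → a' < b' →
        ∑ i ∈ Finset.Ico a' b', F i ≤ 1 / 2 → SegBelow h (M + 2) (z a') (z b') := by
      intro a' b' h1 h2 h3 h4 h5
      have := ih a' b' h3 h4 (M - 2 * δ) (fun i hi hi' => hz i (by omega) (by omega)) (by
        simp only [hshift, ← Finset.mul_sum]
        linarith)
      convert this using 1
      ring
    have hjM := hFM j haj hjb
    have hjz := hz j haj hjb
    have hA : SegBelow h (M + 2) (z a) (z j) := by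
      rcases haj.eq_or_lt with rfl | hlt
      · exact segBelow_of_dist_le (ℓ := 0) hlip (by linarith) (by simp)
      · exact hsub a j le_rfl hjb.le (by omega) hlt hj1
    have hB : SegBelow h (M + 2) (z j) (z (j + 1)) :=
      segBelow_of_dist_le (ℓ := 2) hlip (by linarith) hjz
    have hC : SegBelow h (M + 2) (z (j + 1)) (z b) := by
      rcases (Nat.succ_le_of_lt hjb).eq_or_lt with h1 | hlt
      · rw [← h1]
        have := (abs_le.1 (hlip (z j) (z (j + 1)))).1
        exact segBelow_of_dist_le (ℓ := 0) hlip (by linarith) (by simp)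
      · exact hsub (j + 1) b (by omega) le_rfl (by omega) hlt hj2
    have hAB := hA.trans hH hlip hB
    have hC' : SegBelow h (M + 2 + δ) (z (j + 1)) (z b) := fun c hc r hr =>
      (hC c hc r hr).trans (by linarith)
    have := hAB.trans hH hlip hC'
    convert this using 1
    ring

/-- The defect allowed in `VertSys.dist_le_of_end_max`. -/
def endDefect (δ e : ℝ) : ℝ := 4 * δ * Real.logb 2 (4 * (2 * δ + e)) + 14 * δ

theorem sum_two_rpow_le {δ e : ℝ} (hδ : 1 ≤ δ) (he : 0 ≤ e) (n : ℕ) (d : ℕ → ℝ)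
    (hd0 : ∀ i < n, 0 ≤ d i) (hd : ∀ i < n, (n : ℝ) - 1 - i - e ≤ d i) :
    ∑ i ∈ Finset.range n, (2 : ℝ) ^ (-d i / (2 * δ)) ≤ 4 * (2 * δ + e) := by
  set θ : ℝ := 1 / (2 * δ + e) with hθ
  have hpos : 0 < 2 * δ + e := by linarith
  have hθ0 : 0 < θ := by positivity
  have hθ1 : θ ≤ 1 := by rw [hθ, div_le_one hpos]; linarith
  set ρ : ℝ := (2 : ℝ) ^ (-θ) with hρ
  have hρ0 : 0 < ρ := Real.rpow_pos_of_pos two_pos _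
  have hρ1 : ρ ≤ 1 - θ / 2 := by
    have := rpow_one_add_le_one_add_mul_self (s := -(1 / 2)) (by norm_num) hθ0.le hθ1
    have e1 : (1 + -(1 / 2) : ℝ) ^ θ = ρ := by
      rw [hρ, Real.rpow_neg two_pos.le, ← Real.inv_rpow two_pos.le]; norm_num
    rw [e1] at this
    linarith
  have hterm : ∀ i ∈ Finset.range n,
      (2 : ℝ) ^ (-d i / (2 * δ)) ≤ 2 * ρ ^ (n - 1 - i) := by
    intro i hi
    have hi := Finset.mem_range.1 hi
    have e2 : 2 * ρ ^ (n - 1 - i) = (2 : ℝ) ^ (1 + -θ * ((n : ℝ) - 1 - i)) := by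
      rw [Real.rpow_add two_pos, Real.rpow_one, Real.rpow_mul two_pos.le, ← hρ,
        ← Real.rpow_natCast, Nat.sub_sub, Nat.cast_sub (by omega)]
      push_cast
      ring_nf
    rw [e2]
    refine Real.rpow_le_rpow_of_exponent_le one_le_two ?_
    have h0 := hd0 i hi
    have h1 := hd i hi
    set k : ℝ := (n : ℝ) - 1 - i
    have h2 : θ * k ≤ 1 + d i / (2 * δ) := by
      rw [hθ, one_div_mul_eq_div, div_le_iff₀ hpos]
      have : 0 ≤ d i / (2 * δ) := by positivity
      have h3 : d i / (2 * δ) * (2 * δ) = d i := by field_simp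
      nlinarith
    have h4 : -d i / (2 * δ) = -(d i / (2 * δ)) := by ring
    rw [h4]
    linarith
  calc ∑ i ∈ Finset.range n, (2 : ℝ) ^ (-d i / (2 * δ))
      ≤ ∑ i ∈ Finset.range n, 2 * ρ ^ (n - 1 - i) := Finset.sum_le_sum hterm
    _ = 2 * ∑ i ∈ Finset.range n, ρ ^ i := by
        rw [← Finset.mul_sum, Finset.sum_range_reflect (fun i => ρ ^ i)]
    _ ≤ 2 * (2 / θ) := by
        have h1 : (∑ i ∈ Finset.range n, ρ ^ i) * (1 - ρ) ≤ 1 := by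
          rw [geom_sum_mul_neg]
          have := pow_nonneg hρ0.le n
          linarith
        have h2 : 0 ≤ ∑ i ∈ Finset.range n, ρ ^ i := Finset.sum_nonneg fun i _ => pow_nonneg hρ0.le i
        have h3 : ∑ i ∈ Finset.range n, ρ ^ i ≤ 2 / θ := by
          rw [le_div_iff₀ hθ0]
          nlinarith
        linarith
    _ = 4 * (2 * δ + e) := by rw [hθ]; field_simp; ring

/-- A path which ends at its highest point and climbs with almost unit speed stays close to
being a vertical geodesic. -/
theorem VertSys.dist_le_of_end_max (hV : VertSys δ h V) (hδ : 1 ≤ δ) (hH : DeltaHyperbolic H δ)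
    {p : ℝ → H} {s c : ℝ} (hsc : s ≤ c)
    (hp : ∀ u ∈ Icc s c, ∀ v ∈ Icc s c, dist (p u) (p v) ≤ 2 * |u - v|)
    (hg : ∀ u ∈ Icc s c, ∀ v ∈ Icc s c, |h (p u) - h (p v)| ≤ |u - v|)
    (hmax : ∀ u ∈ Icc s c, h (p u) ≤ h (p c)) :
    dist (p s) (p c) ≤ (h (p c) - h (p s)) + endDefect δ ((c - s) - (h (p c) - h (p s))) := by
  set e : ℝ := (c - s) - (h (p c) - h (p s)) with he
  have hs : s ∈ Icc s c := ⟨le_rfl, hsc⟩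
  have hc : c ∈ Icc s c := ⟨hsc, le_rfl⟩
  have he0 : 0 ≤ e := by
    have := (abs_le.1 (hg s hs c hc)).1
    rw [abs_sub_comm, abs_of_nonneg (by linarith)] at this
    linarith
  have hK : 1 ≤ 4 * (2 * δ + e) := by linarith
  rcases hsc.eq_or_lt with rfl | hlt
  · have : 0 ≤ Real.logb 2 (4 * (2 * δ + e)) := Real.logb_nonneg one_lt_two hK
    rw [_root_.dist_self, sub_self, zero_add, endDefect]
    positivity
  set n := ⌈c - s⌉₊ with hn
  have hn0 : 0 < n := Nat.ceil_pos.2 (by linarith)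
  have hn1 : c - s ≤ n := Nat.le_ceil _
  have hn2 : (n : ℝ) < c - s + 1 := Nat.ceil_lt_add_one (by linarith)
  let τ : ℕ → ℝ := fun i => min (s + i) c
  have hτ : ∀ i, τ i ∈ Icc s c := fun i =>
    ⟨le_min (by linarith [(Nat.cast_nonneg i : (0 : ℝ) ≤ i)]) hsc, min_le_right _ _⟩
  have hτi : ∀ i < n, τ i = s + i := fun i hi => by
    have : (i : ℝ) + 1 ≤ n := by exact_mod_cast hi
    exact min_eq_left (by linarith)
  have hτstep : ∀ i, |τ i - τ (i + 1)| ≤ 1 := fun i => by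
    have := abs_min_sub_min_le_max (s + i) c (s + (i + 1 : ℕ)) c
    refine this.trans ?_
    push_cast
    simp
  set M : ℝ := h (p c) + 2 * δ * Real.logb 2 (4 * (2 * δ + e)) with hM
  have hsum : ∑ i ∈ Finset.Ico 0 n, (2 : ℝ) ^ ((h (p (τ i)) - M) / (2 * δ)) ≤ 1 := by
    have h1 := sum_two_rpow_le hδ he0 n (fun i => h (p c) - h (p (τ i)))
      (fun i _ => by linarith [hmax _ (hτ i)]) (fun i hi => by
        have h2 := (abs_le.1 (hg s hs _ (hτ i))).1
        rw [hτi i hi] at h2 ⊢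
        rw [abs_sub_comm, abs_of_nonneg (by simp)] at h2
        linarith)
    have h2 : ∀ i, (2 : ℝ) ^ ((h (p (τ i)) - M) / (2 * δ)) =
        (2 : ℝ) ^ (-(h (p c) - h (p (τ i))) / (2 * δ)) / (4 * (2 * δ + e)) := by
      intro i
      have e1 : (h (p (τ i)) - M) / (2 * δ) = -(h (p c) - h (p (τ i))) / (2 * δ) -
          Real.logb 2 (4 * (2 * δ + e)) := by
        rw [hM]; field_simp; ring
      rw [e1, Real.rpow_sub two_pos, Real.rpow_logb two_pos (by norm_num) (by linarith)]
    simp only [h2, ← Finset.sum_div, Nat.Ico_zero_eq_range]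
    rw [div_le_one (by linarith)]
    exact h1
  have hlow := segBelow_of_sum_le (by linarith) hH hV.lip (fun i => p (τ i)) n 0 n (by omega) hn0 M
    (fun i _ _ => by linarith [hp _ (hτ i) _ (hτ (i + 1)), hτstep i]) hsum
  have h0 : τ 0 = s := by simp [τ, hsc]
  have h1 : τ n = c := min_eq_right (by linarith)
  simp only [h0, h1] at hlow
  obtain ⟨γ, hγ⟩ := hH.1 (p s) (p c)
  obtain ⟨r, hr, hr'⟩ := hV.exists_high_point hγ
  have := hlow γ hγ r hr
  rw [endDefect]
  linarith

end VertSys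

theorem logb_two_le_self {z : ℝ} (hz : 0 < z) : Real.logb 2 z ≤ z := by
  rw [Real.logb_le_iff_le_rpow one_lt_two hz]
  rcases le_or_gt z 1 with h1 | h1
  · exact h1.trans (Real.one_le_rpow one_le_two hz.le)
  · have := one_add_mul_self_le_rpow_one_add (s := 1) (by norm_num) h1.le
    norm_num at this
    linarith

theorem endDefect_mono {δ e e' : ℝ} (hδ : 1 ≤ δ) (he : 0 ≤ e) (hee : e ≤ e') :
    endDefect δ e ≤ endDefect δ e' := by
  rw [endDefect, endDefect]
  have : Real.logb 2 (4 * (2 * δ + e)) ≤ Real.logb 2 (4 * (2 * δ + e')) :=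
    Real.logb_le_logb_of_le one_lt_two (by linarith) (by linarith)
  gcongr

theorem endDefect_le_linear {δ e C : ℝ} (hδ : 1 ≤ δ) (hC : 1 ≤ C) (he : 0 ≤ e) :
    endDefect δ e ≤ e / (32 * C) + 55 * C * δ ^ 2 := by
  have hCδ : 1 ≤ C * δ := by nlinarith
  have e1 : 4 * (2 * δ + e) = 2 ^ (9 : ℝ) * ((C * δ) * ((2 * δ + e) / (128 * (C * δ)))) := by
    field_simp; norm_num
  have h1 : Real.logb 2 (4 * (2 * δ + e)) ≤ 9 + (C * δ + (2 * δ + e) / (128 * (C * δ))) := by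
    rw [e1, Real.logb_mul (by positivity) (by positivity), Real.logb_mul (by positivity)
      (by positivity), Real.logb_rpow two_pos (by norm_num)]
    have h2 := logb_two_le_self (show 0 < C * δ by positivity)
    have h3 := logb_two_le_self (show 0 < (2 * δ + e) / (128 * (C * δ)) by positivity)
    linarith
  rw [endDefect]
  have h2 : 4 * δ * ((2 * δ + e) / (128 * (C * δ))) = e / (32 * C) + δ / (16 * C) := by
    field_simp; ring
  have h3 : δ / (16 * C) ≤ δ := div_le_self (by linarith) (by linarith)
  have h4 : 4 * δ * Real.logb 2 (4 * (2 * δ + e)) ≤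
      4 * δ * (9 + (C * δ + (2 * δ + e) / (128 * (C * δ)))) := by gcongr
  nlinarith

theorem endDefect_le_of_le {δ e y : ℝ} (hδ : 1 ≤ δ) (hy : δ ≤ y) (he : 0 ≤ e)
    (hey : e ≤ 2 ^ 13 * y ^ 4) : endDefect δ e ≤ 94 * y ^ 2 := by
  have hy1 : 1 ≤ y := hδ.trans hy
  have h0 : y ≤ y ^ 4 := le_self_pow₀ hy1 (by norm_num)
  have h1 : Real.logb 2 (4 * (2 * δ + e)) ≤ 16 + 4 * y := by
    calc Real.logb 2 (4 * (2 * δ + e)) ≤ Real.logb 2 (2 ^ (16 : ℝ) * y ^ 4) := by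
          apply Real.logb_le_logb_of_le one_lt_two (by linarith)
          norm_num
          linarith
      _ = 16 + 4 * Real.logb 2 y := by
          rw [Real.logb_mul (by positivity) (by positivity),
            Real.logb_rpow two_pos (by norm_num), Real.logb_pow]
          norm_num
      _ ≤ 16 + 4 * y := by linarith [logb_two_le_self (show 0 < y by linarith)]
  rw [endDefect]
  have h2 : 4 * δ * Real.logb 2 (4 * (2 * δ + e)) ≤ 4 * y * (16 + 4 * y) := by
    calc _ ≤ 4 * δ * (16 + 4 * y) := by gcongr
      _ ≤ _ := by gcongr
  nlinarith

section AdmNorm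

variable (N : AdmNorm)

/-- The admissible norm with the two coordinates exchanged. -/
def AdmNorm.swap : AdmNorm where
  toFun v := N.toFun v.swap
  eq_zero_iff v := by
    rw [N.eq_zero_iff, Prod.ext_iff, Prod.ext_iff]
    exact and_comm
  smul_eq c v := by rw [← N.smul_eq]; rfl
  add_le v w := by rw [Prod.swap_add]; exact N.add_le _ _
  one_one := N.one_one
  adm a b := by rw [add_comm]; exact N.adm b a

variable {N}

theorem AdmNorm.BoundConst.swap {C : ℝ} (hC : N.BoundConst C) : N.swap.BoundConst C :=
  ⟨hC.1, fun a b ha hb => by rw [add_comm]; exact hC.2 b a hb ha⟩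

theorem AdmNorm.le_add_sub (N : AdmNorm) (a b a' b' : ℝ) :
    N.toFun (a, b) ≤ N.toFun (a', b') + N.toFun (a - a', b - b') := by
  have := N.add_le (a', b') (a - a', b - b')
  rwa [Prod.mk_add_mk, add_sub_cancel, add_sub_cancel] at this

theorem AdmNorm.left_eq (N : AdmNorm) (a : ℝ) : N.toFun (a, 0) = |a| * N.toFun (1, 0) := by
  simpa using N.smul_eq a (1, 0)

theorem AdmNorm.right_eq (N : AdmNorm) (a : ℝ) : N.toFun (0, a) = |a| * N.toFun (0, 1) := by
  simpa using N.smul_eq a (0, 1)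

theorem AdmNorm.diag_eq (N : AdmNorm) (a : ℝ) : N.toFun (a, a) = |a| := by
  have := N.smul_eq a (1, 1)
  rwa [N.one_one, Prod.smul_mk, smul_eq_mul, mul_one, mul_one] at this

theorem AdmNorm.BoundConst.le_abs {C : ℝ} (hC : N.BoundConst C) (a b : ℝ) :
    N.toFun (a, b) ≤ C * (|a| + |b|) / 2 := by
  have h1 := N.le_add_sub a b a 0
  rw [sub_self, sub_zero, N.left_eq a, N.right_eq b] at h1
  have h2 := hC.2 1 0 zero_le_one le_rfl
  have h3 := hC.2 0 1 le_rfl zero_le_one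
  nlinarith only [abs_nonneg a, abs_nonneg b, h1, h2, h3]

/-- The maximal speed needed along a path which is steep in the second factor. -/
def AdmNorm.rightSlope (N : AdmNorm) : ℝ := max 1 (N.toFun (0, 1))

theorem AdmNorm.BoundConst.rightSlope_le {C : ℝ} (hC : N.BoundConst C) : N.rightSlope ≤ C := by
  have h3 := hC.2 0 1 le_rfl zero_le_one
  exact max_le hC.1 (by linarith [hC.1])

theorem AdmNorm.le_rightSlope_mul {a b : ℝ} (ha : 0 ≤ a) (hab : a ≤ b) :
    N.toFun (a, b) ≤ N.rightSlope * b := by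
  have h1 := N.le_add_sub a b a a
  rw [sub_self, N.right_eq, N.diag_eq, abs_of_nonneg ha, abs_of_nonneg (sub_nonneg.2 hab)] at h1
  have h2 : 1 ≤ N.rightSlope := le_max_left _ _
  have h3 : N.toFun (0, 1) ≤ N.rightSlope := le_max_right _ _
  nlinarith

theorem AdmNorm.BoundConst.rightSlope_sub_one_mul_le {C : ℝ} (hC : N.BoundConst C) {a b r : ℝ}
    (ha : 0 ≤ a) (hb : 0 ≤ b) (hr : N.toFun (a, b) ≤ r) :
    (N.rightSlope - 1) * b ≤ max 0 (r - b + C * a) := by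
  rcases le_total (N.toFun (0, 1)) 1 with h1 | h1
  · simp [AdmNorm.rightSlope, max_eq_left h1]
  · refine le_max_of_le_right ?_
    rw [AdmNorm.rightSlope, max_eq_right h1]
    have h2 := N.le_add_sub 0 b a b
    have h3 := hC.le_abs (0 - a) (b - b)
    rw [N.right_eq, abs_of_nonneg hb] at h2
    simp only [zero_sub, sub_self, abs_neg, abs_of_nonneg ha, abs_zero, add_zero] at h2 h3
    nlinarith [hC.1]

end AdmNorm

section Reach

variable {hp : Hp → ℝ} {hq : Hq → ℝ}

/-- There is a path of `N`-speed at most one and duration `r` in the level set `hp + hq = 0`. -/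
def Reach (N : AdmNorm) (hp : Hp → ℝ) (hq : Hq → ℝ) (r : ℝ) (x y : Hp × Hq) : Prop :=
  0 ≤ r ∧ ∃ γ : ℝ → Hp × Hq, γ 0 = x ∧ γ r = y ∧
    (∀ t ∈ Icc 0 r, hp (γ t).1 + hq (γ t).2 = 0) ∧
    ∀ s t, 0 ≤ s → s ≤ t → t ≤ r →
      N.toFun (dist (γ s).1 (γ t).1, dist (γ s).2 (γ t).2) ≤ t - s

/-- There is a path of duration `r` in the level set `hp + hq = 0` both of whose components are
`1`-Lipschitz. -/
def LipReach (hp : Hp → ℝ) (hq : Hq → ℝ) (r : ℝ) (x y : Hp × Hq) : Prop :=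
  0 ≤ r ∧ ∃ γ : ℝ → Hp × Hq, γ 0 = x ∧ γ r = y ∧
    (∀ t ∈ Icc 0 r, hp (γ t).1 + hq (γ t).2 = 0) ∧
    ∀ s t, 0 ≤ s → s ≤ t → t ≤ r → dist (γ s).1 (γ t).1 ≤ t - s ∧ dist (γ s).2 (γ t).2 ≤ t - s

variable {N : AdmNorm} {r ℓ C : ℝ} {x y z : Hp × Hq}

theorem Reach.symm (h : Reach N hp hq r x y) : Reach N hp hq r y x := by
  obtain ⟨hr, γ, h0, h1, hmem, hN⟩ := h
  refine ⟨hr, fun t => γ (r - t), by simp [h1], by simp [h0],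
    fun t ht => hmem _ ⟨by linarith [ht.2], by linarith [ht.1]⟩, fun s t hs hst ht => ?_⟩
  have := hN (r - t) (r - s) (by linarith) (by linarith) (by linarith)
  rw [dist_comm (γ (r - s)).1, dist_comm (γ (r - s)).2]
  linarith

theorem LipReach.symm (h : LipReach hp hq r x y) : LipReach hp hq r y x := by
  obtain ⟨hr, γ, h0, h1, hmem, hN⟩ := h
  refine ⟨hr, fun t => γ (r - t), by simp [h1], by simp [h0],
    fun t ht => hmem _ ⟨by linarith [ht.2], by linarith [ht.1]⟩, fun s t hs hst ht => ?_⟩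
  have := hN (r - t) (r - s) (by linarith) (by linarith) (by linarith)
  rw [dist_comm (γ (r - s)).1, dist_comm (γ (r - s)).2]
  exact ⟨by linarith, by linarith⟩

theorem Reach.swap (h : Reach N.swap hq hp r x.swap y.swap) : Reach N hp hq r x y := by
  obtain ⟨hr, γ, h0, h1, hmem, hN⟩ := h
  exact ⟨hr, fun t => (γ t).swap, by simp [h0], by simp [h1],
    fun t ht => by rw [add_comm]; exact hmem t ht, hN⟩

theorem LipReach.swap (h : LipReach hq hp r x.swap y.swap) : LipReach hp hq r x y := by
  obtain ⟨hr, γ, h0, h1, hmem, hN⟩ := h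
  exact ⟨hr, fun t => (γ t).swap, by simp [h0], by simp [h1],
    fun t ht => by rw [add_comm]; exact hmem t ht, fun s t hs hst ht => (hN s t hs hst ht).symm⟩

theorem Reach.append (hC : N.BoundConst C) (h : Reach N hp hq r x y)
    (h' : LipReach hp hq ℓ y z) : Reach N hp hq (r + C * ℓ) x z := by
  obtain ⟨hr, γ, h0, h1, hmem, hN⟩ := h
  obtain ⟨hℓ, c, g0, g1, gmem, gN⟩ := h'
  have hCpos : 0 < C := by linarith [hC.1]
  have hCℓ : 0 ≤ C * ℓ := by positivity
  have key : ∀ t, r < t → t ≤ r + C * ℓ → 0 ≤ (t - r) / C ∧ (t - r) / C ≤ ℓ := fun t h1 h2 =>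
    ⟨div_nonneg (by linarith) hCpos.le, by rw [div_le_iff₀ hCpos]; linarith⟩
  refine ⟨by linarith, fun t => if t ≤ r then γ t else c ((t - r) / C), ?_, ?_, ?_, ?_⟩
  · simp [hr, h0]
  · rcases hℓ.eq_or_lt with h2 | h2
    · subst h2
      simp [h1, ← g1, g0]
    · have : ¬ (r + C * ℓ ≤ r) := by
        have : 0 < C * ℓ := by positivity
        linarith
      simp only [this, if_false]
      rw [add_sub_cancel_left, mul_div_cancel_left₀ _ hCpos.ne', g1]
  · intro t ht
    simp only
    split_ifs with h2
    · exact hmem t ⟨ht.1, h2⟩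
    · exact gmem _ (key t (not_le.1 h2) ht.2)
  · intro s t hs hst ht
    simp only
    by_cases h2 : t ≤ r
    · rw [if_pos h2, if_pos (hst.trans h2)]
      exact hN s t hs hst h2
    rw [if_neg h2]
    have hkt := key t (not_le.1 h2) ht
    by_cases h3 : s ≤ r
    · rw [if_pos h3]
      have e1 := hN s r hs h3 le_rfl
      rw [h1] at e1
      have e2 := gN 0 ((t - r) / C) le_rfl hkt.1 hkt.2
      rw [g0, sub_zero, dist_comm y.1, dist_comm y.2] at e2
      have e3 := N.le_add_sub (dist (γ s).1 (c ((t - r) / C)).1)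
        (dist (γ s).2 (c ((t - r) / C)).2) (dist (γ s).1 y.1) (dist (γ s).2 y.2)
      have e4 := hC.le_abs
        (dist (γ s).1 (c ((t - r) / C)).1 - dist (γ s).1 y.1)
        (dist (γ s).2 (c ((t - r) / C)).2 - dist (γ s).2 y.2)
      have e5 := abs_dist_sub_le (c ((t - r) / C)).1 y.1 (γ s).1
      have e6 := abs_dist_sub_le (c ((t - r) / C)).2 y.2 (γ s).2
      rw [dist_comm _ (γ s).1, dist_comm _ (γ s).1] at e5
      rw [dist_comm _ (γ s).2, dist_comm _ (γ s).2] at e6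
      have e7 : C * (|dist (γ s).1 (c ((t - r) / C)).1 - dist (γ s).1 y.1| +
          |dist (γ s).2 (c ((t - r) / C)).2 - dist (γ s).2 y.2|) / 2 ≤
          C * ((t - r) / C + (t - r) / C) / 2 := by
        gcongr
        · exact e5.trans e2.1
        · exact e6.trans e2.2
      have e8 : C * ((t - r) / C + (t - r) / C) / 2 = t - r := by field_simp; ring
      linarith
    · rw [if_neg h3]
      have hks := key s (not_le.1 h3) (hst.trans ht)
      have hle : (s - r) / C ≤ (t - r) / C := by gcongr
      have e2 := gN _ _ hks.1 hle hkt.2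
      refine (hC.2 _ _ dist_nonneg dist_nonneg).trans ?_
      calc _ ≤ C * (((t - r) / C - (s - r) / C) + ((t - r) / C - (s - r) / C)) / 2 := by
            gcongr
            exacts [e2.1, e2.2]
        _ = t - s := by field_simp; ring

theorem Reach.prepend (hC : N.BoundConst C) (h' : LipReach hp hq ℓ x y)
    (h : Reach N hp hq r y z) : Reach N hp hq (C * ℓ + r) x z := by
  rw [add_comm]
  exact (h.symm.append hC h'.symm).symm

variable {δ : ℝ} {Vp : Hp → ℝ → Hp} {Vq : Hq → ℝ → Hq}

/-- Moving along a geodesic of the second factor, and along a vertical line in the first. -/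
theorem LipReach.of_geodesic_right (hVp : VertSys δ hp Vp) (hlip : ∀ a b, |hq a - hq b| ≤ dist a b)
    (hS : GeodesicSpace Hq) (xp : Hp) {s : ℝ} {xq yq : Hq} (hx : hp xp + s + hq xq = 0) :
    LipReach hp hq (dist xq yq) (Vp xp s, xq) (Vp xp (s + hq xq - hq yq), yq) := by
  obtain ⟨c, hc⟩ := hS xq yq
  refine ⟨dist_nonneg, fun t => (Vp xp (s + hq xq - hq (c t)), c t), ?_, ?_, ?_, ?_⟩
  · simp [hc.2.1]
  · simp [hc.2.2]
  · intro t ht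
    simp only [hVp.height]
    linarith
  · intro a b ha hab hb
    have e1 := hc.1 a ⟨ha, hab.trans hb⟩ b ⟨ha.trans hab, hb⟩
    rw [abs_sub_comm, abs_of_nonneg (sub_nonneg.2 hab)] at e1
    have e2 := hlip (c a) (c b)
    simp only [hVp.isom]
    refine ⟨?_, e1.le⟩
    rw [show s + hq xq - hq (c a) - (s + hq xq - hq (c b)) = -(hq (c a) - hq (c b)) by ring,
      abs_neg]
    exact e2.trans e1.le

theorem LipReach.of_geodesic_left (hVq : VertSys δ hq Vq) (hlip : ∀ a b, |hp a - hp b| ≤ dist a b)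
    (hS : GeodesicSpace Hp) (xq : Hq) {s : ℝ} {xp yp : Hp} (hx : hq xq + s + hp xp = 0) :
    LipReach hp hq (dist xp yp) (xp, Vq xq s) (yp, Vq xq (s + hp xp - hp yp)) :=
  LipReach.swap (LipReach.of_geodesic_right hVq hlip hS xq hx)

/-- The comparison path: correct the second coordinate, go up, correct the first coordinate. -/
theorem Reach.of_relative_dist (hC : N.BoundConst C) (hSp : GeodesicSpace Hp)
    (hSq : GeodesicSpace Hq) (hVp : VertSys δ hp Vp) (hVq : VertSys δ hq Vq)
    (hx : hp x.1 + hq x.2 = 0) (hy : hp y.1 + hq y.2 = 0) (hxy : hp x.1 ≤ hp y.1) :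
    ∃ r, r ≤ hp y.1 - hp x.1 + C * ((dist x.1 y.1 - (hp y.1 - hp x.1)) +
        (dist x.2 y.2 - (hp y.1 - hp x.1)) + 8 * δ) ∧ Reach N hp hq r x y := by
  set Δ := hp y.1 - hp x.1 with hΔ
  have hCpos : 0 ≤ C := by linarith [hC.1]
  have hqΔ : hq x.2 - hq y.2 = Δ := by linarith
  have hA : LipReach hp hq (dist x.2 (Vq y.2 Δ)) x (x.1, Vq y.2 Δ) := by
    have := LipReach.of_geodesic_right (hp := hp) (hq := hq) hVp hVq.lip hSq x.1 (s := 0)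
      (xq := x.2) (yq := Vq y.2 Δ) (by linarith)
    rw [hVq.height, show (0 : ℝ) + hq x.2 - (hq y.2 + Δ) = 0 by linarith, hVp.zero] at this
    exact this
  have hB : Reach N hp hq Δ (x.1, Vq y.2 Δ) (Vp x.1 Δ, y.2) := by
    refine ⟨by linarith, fun t => (Vp x.1 t, Vq y.2 (Δ - t)), by simp [hVp.zero],
      by simp [hVq.zero], fun t ht => ?_, fun s t hs hst ht => ?_⟩
    · simp only [hVp.height, hVq.height]
      linarith
    · simp only [hVp.isom, hVq.isom]
      rw [show Δ - s - (Δ - t) = -(s - t) by ring, abs_neg, N.diag_eq, abs_abs, abs_sub_comm,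
        abs_of_nonneg (by linarith)]
  have hD : LipReach hp hq (dist (Vp x.1 Δ) y.1) (Vp x.1 Δ, y.2) y := by
    have := LipReach.of_geodesic_left (hp := hp) (hq := hq) hVq hVp.lip hSp y.2 (s := 0)
      (xp := Vp x.1 Δ) (yp := y.1) (by rw [hVp.height]; linarith)
    rw [hVp.height, show (0 : ℝ) + (hp x.1 + Δ) - hp y.1 = 0 by linarith, hVq.zero] at this
    exact this
  refine ⟨_, ?_, (hB.prepend hC hA).append hC hD⟩
  have e1 := hVq.dist_vert_le hSq y.2 x.2
  have e2 := hVp.dist_vert_le hSp x.1 y.1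
  rw [hqΔ, dist_comm, dist_comm y.2] at e1
  rw [← hΔ] at e2
  have : C * dist x.2 (Vq y.2 Δ) + C * dist (Vp x.1 Δ) y.1 ≤
      C * (dist x.2 y.2 - Δ + 4 * δ) + C * (dist x.1 y.1 - Δ + 4 * δ) := by gcongr
  linarith

/-- The comparison path following a geodesic of the second factor. -/
theorem Reach.of_dist_right (hC : N.BoundConst C) (hSp : GeodesicSpace Hp)
    (hSq : GeodesicSpace Hq) (hVp : VertSys δ hp Vp) (hVq : VertSys δ hq Vq)
    (hx : hp x.1 + hq x.2 = 0) (hy : hp y.1 + hq y.2 = 0) :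
    ∃ r, r ≤ N.rightSlope * dist x.2 y.2 + C * (dist x.1 y.1 - |hp x.1 - hp y.1| + 4 * δ) ∧
      Reach N hp hq r x y := by
  wlog hxy : hp x.1 ≤ hp y.1 generalizing x y
  · obtain ⟨r, hr, h⟩ := this hy hx (le_of_not_ge hxy)
    refine ⟨r, ?_, h.symm⟩
    rwa [dist_comm x.2, dist_comm x.1, abs_sub_comm]
  have hCpos : 0 ≤ C := by linarith [hC.1]
  have hm : 1 ≤ N.rightSlope := le_max_left _ _
  have hmpos : 0 < N.rightSlope := by linarith
  obtain ⟨c, hc⟩ := hSq x.2 y.2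
  have hA : Reach N hp hq (N.rightSlope * dist x.2 y.2) x (Vp x.1 (hp y.1 - hp x.1), y.2) := by
    refine ⟨by positivity, fun t => (Vp x.1 (hq x.2 - hq (c (t / N.rightSlope))),
      c (t / N.rightSlope)), ?_, ?_, ?_, ?_⟩
    · simp [hc.2.1, hVp.zero]
    · simp only [mul_div_cancel_left₀ _ hmpos.ne', hc.2.2]
      rw [show hq x.2 - hq y.2 = hp y.1 - hp x.1 by linarith]
    · intro t ht
      simp only [hVp.height]
      linarith
    · intro a b ha hab hb
      have hab' : a / N.rightSlope ≤ b / N.rightSlope := by gcongr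
      have ha' : 0 ≤ a / N.rightSlope := by positivity
      have hb' : b / N.rightSlope ≤ dist x.2 y.2 := by
        rw [div_le_iff₀ hmpos]; linarith
      have e1 := hc.1 _ ⟨ha', hab'.trans hb'⟩ _ ⟨ha'.trans hab', hb'⟩
      rw [abs_sub_comm, abs_of_nonneg (sub_nonneg.2 hab')] at e1
      have e2 := hVq.lip (c (a / N.rightSlope)) (c (b / N.rightSlope))
      simp only [hVp.isom]
      rw [show hq x.2 - hq (c (a / N.rightSlope)) - (hq x.2 - hq (c (b / N.rightSlope))) =
        -(hq (c (a / N.rightSlope)) - hq (c (b / N.rightSlope))) by ring, abs_neg]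
      refine (AdmNorm.le_rightSlope_mul (abs_nonneg _) e2).trans ?_
      rw [e1]
      have : N.rightSlope * (b / N.rightSlope - a / N.rightSlope) = b - a := by field_simp
      exact this.le
  have hD : LipReach hp hq (dist (Vp x.1 (hp y.1 - hp x.1)) y.1)
      (Vp x.1 (hp y.1 - hp x.1), y.2) y := by
    have := LipReach.of_geodesic_left (hp := hp) (hq := hq) hVq hVp.lip hSp y.2 (s := 0)
      (xp := Vp x.1 (hp y.1 - hp x.1)) (yp := y.1) (by rw [hVp.height]; linarith)
    rw [hVp.height, show (0 : ℝ) + (hp x.1 + (hp y.1 - hp x.1)) - hp y.1 = 0 by ring,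
      hVq.zero] at this
    exact this
  refine ⟨_, ?_, hA.append hC hD⟩
  rw [abs_sub_comm, abs_of_nonneg (sub_nonneg.2 hxy)]
  gcongr
  exact hVp.dist_vert_le hSp x.1 y.1

theorem Reach.of_dist_left (hC : N.BoundConst C) (hSp : GeodesicSpace Hp)
    (hSq : GeodesicSpace Hq) (hVp : VertSys δ hp Vp) (hVq : VertSys δ hq Vq)
    (hx : hp x.1 + hq x.2 = 0) (hy : hp y.1 + hq y.2 = 0) :
    ∃ r, r ≤ N.swap.rightSlope * dist x.1 y.1 + C * (dist x.2 y.2 - |hq x.2 - hq y.2| + 4 * δ) ∧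
      Reach N hp hq r x y := by
  obtain ⟨r, hr, h⟩ := Reach.of_dist_right hC.swap hSq hSp hVq hVp (x := x.swap) (y := y.swap)
    (by rw [add_comm]; exact hx) (by rw [add_comm]; exact hy)
  exact ⟨r, hr, h.swap⟩

theorem Reach.lN_le {γ : ℝ → Hp × Hq}
    (hN : ∀ s t, 0 ≤ s → s ≤ t → t ≤ r →
      N.toFun (dist (γ s).1 (γ t).1, dist (γ s).2 (γ t).2) ≤ t - s) :
    lN N.toFun γ (Icc 0 r) ≤ ENNReal.ofReal r := by
  refine iSup_le ?_
  rintro ⟨n, u, hu, hmem⟩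
  calc _ ≤ ∑ i ∈ Finset.range n, ENNReal.ofReal (u (i + 1) - u i) := by
        refine Finset.sum_le_sum fun i _ => ENNReal.ofReal_le_ofReal ?_
        have := hN (u i) (u (i + 1)) (hmem i).1 (hu i.le_succ) (hmem (i + 1)).2
        simpa only [dist_comm] using this
    _ = ENNReal.ofReal (u n - u 0) := by
        rw [← ENNReal.ofReal_sum_of_nonneg fun i _ => sub_nonneg.2 (hu i.le_succ),
          Finset.sum_range_sub]
    _ ≤ _ := ENNReal.ofReal_le_ofReal (by linarith [(hmem n).2, (hmem 0).1])

theorem Reach.dHN_le {wp : Hp} {ap : ℝ → Hp} {wq : Hq} {aq : ℝ → Hq}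
    (h : Reach N (height wp ap) (height wq aq) r x y) :
    dHN N.toFun (inHoro wp ap wq aq) x y ≤ ENNReal.ofReal r := by
  obtain ⟨hr, γ, h0, h1, hmem, hN⟩ := h
  have hcont : ContinuousOn γ (Icc 0 r) := by
    have hle : ∀ s t, 0 ≤ s → s ≤ t → t ≤ r → dist (γ s) (γ t) ≤ 2 * (t - s) := by
      intro s t hs hst ht
      have h2 := hN s t hs hst ht
      have h3 := N.adm (dist (γ s).1 (γ t).1) (dist (γ s).2 (γ t).2)
      rw [Prod.dist_eq]
      exact max_le (by linarith [dist_nonneg (x := (γ s).2) (y := (γ t).2)])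
        (by linarith [dist_nonneg (x := (γ s).1) (y := (γ t).1)])
    refine (LipschitzOnWith.of_dist_le_mul (K := 2) fun s hs t ht => ?_).continuousOn
    rw [Real.dist_eq, NNReal.coe_ofNat]
    rcases le_total s t with hst | hst
    · rw [abs_sub_comm, abs_of_nonneg (sub_nonneg.2 hst)]
      exact hle s t hs.1 hst ht.2
    · rw [dist_comm, abs_of_nonneg (sub_nonneg.2 hst)]
      exact hle t s ht.1 hst hs.2
  exact (iInf₂_le_of_le r hr <| iInf₂_le_of_le γ hcont <| iInf₂_le_of_le hmem h0 <|
    iInf_le_of_le h1 le_rfl).trans (Reach.lN_le hN)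

theorem ofReal_le_lN {γ : ℝ → Hp × Hq} {Nf : ℝ × ℝ → ℝ} {T : ℝ} (hT : 0 ≤ T) :
    ENNReal.ofReal (Nf (dist (γ 0).1 (γ T).1, dist (γ 0).2 (γ T).2)) ≤ lN Nf γ (Icc 0 T) := by
  have hu : Monotone fun i : ℕ => if i = 0 then 0 else T := by
    intro i j hij
    simp only
    split_ifs with h1 h2
    exacts [le_rfl, hT, absurd (by omega) h1, le_rfl]
  have hmem : ∀ i : ℕ, (if i = 0 then 0 else T) ∈ Icc 0 T := fun i => by
    split_ifs
    exacts [⟨le_rfl, hT⟩, ⟨hT, le_rfl⟩]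
  refine le_trans ?_ (le_iSup _ (1, ⟨_, hu, hmem⟩))
  simp [dist_comm]

theorem ofReal_le_dHN {Nf : ℝ × ℝ → ℝ} {mem : Hp × Hq → Prop} :
    ENNReal.ofReal (Nf (dist x.1 y.1, dist x.2 y.2)) ≤ dHN Nf mem x y := by
  refine le_iInf₂ fun T hT => le_iInf₂ fun γ _ => le_iInf₂ fun _ h0 => le_iInf fun h1 => ?_
  have := ofReal_le_lN (Nf := Nf) (γ := γ) hT
  rwa [h0, h1] at this

end Reach

/-- The properties of one component of a geodesic of the horospherical product used below:
`g` is the height and `d` the distance between points of the component. -/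
structure HalfConfig (δ L : ℝ) (g : ℝ → ℝ) (d : ℝ → ℝ → ℝ) : Prop where
  symm : ∀ s t, d s t = d t s
  tri : ∀ s t u, d s u ≤ d s t + d t u
  lip : ∀ s ∈ Icc 0 L, ∀ t ∈ Icc 0 L, |g s - g t| ≤ d s t
  end_max : ∀ s ∈ Icc 0 L, ∀ t ∈ Icc 0 L, (∀ u ∈ uIcc s t, g u ≤ g t) →
    d s t ≤ (g t - g s) + endDefect δ (|s - t| - (g t - g s))
  join : ∀ z ∈ Icc 0 L, ∀ s ∈ Icc 0 L, ∀ t ∈ Icc 0 L, g z ≤ g s → g z ≤ g t →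
    d s t ≤ |g s - g t| + (d z s - (g s - g z)) + (d z t - (g t - g z)) + 8 * δ
  merge : ∀ s ∈ Icc 0 L, ∀ t ∈ Icc 0 L, ∃ a b : ℝ, 0 ≤ a ∧ 0 ≤ b ∧
    |(g s + a) - (g t + b)| ≤ 2 * δ ∧ a + b ≤ d s t + 2 * δ ∧
    ∀ s' ∈ Icc 0 L, ∀ t' ∈ Icc 0 L, g s' = g s + a → g t' = g t + b →
      d s' t' ≤ (d s s' - a) + (d t t' - b) + 10 * δ

/-- The properties of a geodesic of the horospherical product used below: `g` is the height, `dp`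
and `dq` are the distances between points of the two components. -/
structure Config (δ C m n L : ℝ) (g : ℝ → ℝ) (dp dq : ℝ → ℝ → ℝ) : Prop where
  left : HalfConfig δ L g dp
  right : HalfConfig δ L (fun t => -g t) dq
  sum_le : ∀ s ∈ Icc 0 L, ∀ t ∈ Icc 0 L, dp s t + dq s t ≤ 2 * |s - t|
  le_relative : ∀ s ∈ Icc 0 L, ∀ t ∈ Icc 0 L,
    |s - t| ≤ |g s - g t| + C * ((dp s t - |g s - g t|) + (dq s t - |g s - g t|) + 8 * δ)
  le_right : ∀ s ∈ Icc 0 L, ∀ t ∈ Icc 0 L,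
    |s - t| ≤ m * dq s t + C * (dp s t - |g s - g t| + 4 * δ)
  le_left : ∀ s ∈ Icc 0 L, ∀ t ∈ Icc 0 L,
    |s - t| ≤ n * dp s t + C * (dq s t - |g s - g t| + 4 * δ)
  slope_right : ∀ s ∈ Icc 0 L, ∀ t ∈ Icc 0 L,
    (m - 1) * dq s t ≤ max 0 (|s - t| - dq s t + C * dp s t)
  slope_left : ∀ s ∈ Icc 0 L, ∀ t ∈ Icc 0 L,
    (n - 1) * dp s t ≤ max 0 (|s - t| - dp s t + C * dq s t)
  one_le_right : 1 ≤ m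
  one_le_left : 1 ≤ n
  right_le : m ≤ C
  left_le : n ≤ C

theorem HalfConfig.reverse {δ L : ℝ} {g : ℝ → ℝ} {d : ℝ → ℝ → ℝ} (h : HalfConfig δ L g d) :
    HalfConfig δ L (fun t => g (L - t)) (fun s t => d (L - s) (L - t)) := by
  have hm : ∀ t ∈ Icc 0 L, L - t ∈ Icc 0 L := fun t ht =>
    ⟨by linarith [ht.2], by linarith [ht.1]⟩
  refine ⟨fun s t => h.symm _ _, fun s t u => h.tri _ _ _,
    fun s hs t ht => h.lip _ (hm s hs) _ (hm t ht), fun s hs t ht hmax => ?_,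
    fun z hz s hs t ht => h.join _ (hm z hz) _ (hm s hs) _ (hm t ht), fun s hs t ht => ?_⟩
  · have := h.end_max _ (hm s hs) _ (hm t ht) (fun u hu => by
      have hu' : L - u ∈ uIcc s t := by
        rw [mem_uIcc] at hu ⊢
        rcases hu with hu | hu
        · exact Or.inr ⟨by linarith, by linarith⟩
        · exact Or.inl ⟨by linarith, by linarith⟩
      simpa using hmax _ hu')
    rwa [show L - s - (L - t) = -(s - t) by ring, abs_neg] at this
  · obtain ⟨a, b, ha, hb, hab, hab', H⟩ := h.merge _ (hm s hs) _ (hm t ht)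
    exact ⟨a, b, ha, hb, hab, hab', fun s' hs' t' ht' => H _ (hm s' hs') _ (hm t' ht')⟩

namespace Config

variable {δ C m n L : ℝ} {g : ℝ → ℝ} {dp dq : ℝ → ℝ → ℝ}

theorem swap (h : Config δ C m n L g dp dq) : Config δ C n m L (fun t => -g t) dq dp where
  left := h.right
  right := by simpa using h.left
  sum_le s hs t ht := by rw [add_comm]; exact h.sum_le s hs t ht
  le_relative s hs t ht := by
    have := h.le_relative s hs t ht
    rwa [neg_sub_neg, abs_sub_comm (g t), add_comm (dq s t - _)]
  le_right s hs t ht := by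
    rw [neg_sub_neg, abs_sub_comm (g t)]
    exact h.le_left s hs t ht
  le_left s hs t ht := by
    rw [neg_sub_neg, abs_sub_comm (g t)]
    exact h.le_right s hs t ht
  slope_right := h.slope_left
  slope_left := h.slope_right
  one_le_right := h.one_le_left
  one_le_left := h.one_le_right
  right_le := h.left_le
  left_le := h.right_le

theorem reverse (h : Config δ C m n L g dp dq) :
    Config δ C m n L (fun t => g (L - t)) (fun s t => dp (L - s) (L - t))
      (fun s t => dq (L - s) (L - t)) := by
  have hm : ∀ t ∈ Icc 0 L, L - t ∈ Icc 0 L := fun t ht =>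
    ⟨by linarith [ht.2], by linarith [ht.1]⟩
  have ha : ∀ s t, |L - s - (L - t)| = |s - t| := fun s t => by
    rw [show L - s - (L - t) = -(s - t) by ring, abs_neg]
  refine ⟨h.left.reverse, h.right.reverse, fun s hs t ht => ?_, fun s hs t ht => ?_,
    fun s hs t ht => ?_, fun s hs t ht => ?_, fun s hs t ht => ?_, fun s hs t ht => ?_,
    h.one_le_right, h.one_le_left, h.right_le, h.left_le⟩ <;> rw [← ha s t]
  · exact h.sum_le _ (hm s hs) _ (hm t ht)
  · exact h.le_relative _ (hm s hs) _ (hm t ht)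
  · exact h.le_right _ (hm s hs) _ (hm t ht)
  · exact h.le_left _ (hm s hs) _ (hm t ht)
  · exact h.slope_right _ (hm s hs) _ (hm t ht)
  · exact h.slope_left _ (hm s hs) _ (hm t ht)

theorem abs_sub_le (h : Config δ C m n L g dp dq) {s t : ℝ} (hs : s ∈ Icc 0 L)
    (ht : t ∈ Icc 0 L) : |g s - g t| ≤ |s - t| := by
  have h1 := h.left.lip s hs t ht
  have h2 := h.right.lip s hs t ht
  rw [neg_sub_neg, abs_sub_comm] at h2
  linarith [h.sum_le s hs t ht]

theorem continuousOn (h : Config δ C m n L g dp dq) : ContinuousOn g (Icc 0 L) :=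
  (LipschitzOnWith.of_dist_le_mul (K := 1) fun s hs t ht => by
    simpa [Real.dist_eq] using h.abs_sub_le hs ht).continuousOn

theorem left_le_of_le (h : Config δ C m n L g dp dq) {s t : ℝ} (hs : s ∈ Icc 0 L)
    (ht : t ∈ Icc 0 L) : dp s t ≤ 2 * |s - t| - |g s - g t| := by
  have h2 := h.right.lip s hs t ht
  rw [neg_sub_neg, abs_sub_comm] at h2
  linarith [h.sum_le s hs t ht]

theorem right_le_of_le (h : Config δ C m n L g dp dq) {s t : ℝ} (hs : s ∈ Icc 0 L)
    (ht : t ∈ Icc 0 L) : dq s t ≤ 2 * |s - t| - |g s - g t| := by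
  linarith [h.sum_le s hs t ht, h.left.lip s hs t ht]

/-- A piece of a geodesic on which both height extrema are attained at the endpoints is almost
vertical. -/
theorem excess_le (h : Config δ C m n L g dp dq) (hδ : 1 ≤ δ) (hC : 1 ≤ C) {s t : ℝ}
    (hs : s ∈ Icc 0 L) (ht : t ∈ Icc 0 L) (hst : ∀ u ∈ uIcc s t, g s ≤ g u ∧ g u ≤ g t) :
    |s - t| - (g t - g s) ≤ 130 * (C * δ) ^ 2 := by
  have h1 := h.left.end_max s hs t ht fun u hu => (hst u hu).2
  have h2 := h.right.end_max t ht s hs fun u hu => by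
    rw [uIcc_comm] at hu
    exact neg_le_neg (hst u hu).1
  rw [neg_sub_neg, abs_sub_comm t s, h.right.symm] at h2
  have h3 := h.le_relative s hs t ht
  have h4 := h.abs_sub_le hs ht
  have h5 : |g s - g t| = g t - g s := by
    rw [abs_sub_comm, abs_of_nonneg (sub_nonneg.2 (hst s left_mem_uIcc).2)]
  rw [h5] at h3 h4
  set e := |s - t| - (g t - g s)
  have h6 := endDefect_le_linear (e := e) hδ hC (by linarith)
  have h7 : C * ((dp s t - (g t - g s)) + (dq s t - (g t - g s)) + 8 * δ) ≤
      C * (2 * (e / (32 * C) + 55 * C * δ ^ 2) + 8 * δ) := by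
    gcongr
    linarith
  have h8 : C * (2 * (e / (32 * C) + 55 * C * δ ^ 2) + 8 * δ) =
      e / 16 + 110 * (C * δ) ^ 2 + 8 * (C * δ) := by
    field_simp; ring
  have h9 : 1 ≤ C * δ := by nlinarith
  nlinarith

/-- If the minimum of the height on `[0, β]` is attained at `τ` and its maximum at `β`, then the
second component is almost geodesic on `[0, τ]` and the first one almost on `[0, β]`. -/
theorem first_leg (h : Config δ C m n L g dp dq) (hδ : 1 ≤ δ) (hC : 1 ≤ C) {τ β : ℝ}
    (hτ : 0 ≤ τ) (hτβ : τ ≤ β) (hβ : β ≤ L) (hmin : ∀ u ∈ Icc 0 β, g τ ≤ g u)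
    (hmax : ∀ u ∈ Icc 0 β, g u ≤ g β) :
    dq 0 τ ≤ g 0 - g τ + 882 * (C * δ) ^ 2 ∧ dp 0 β ≤ g β - g 0 + 882 * (C * δ) ^ 2 := by
  have hmem : ∀ {u}, 0 ≤ u → u ≤ β → u ∈ Icc 0 L := fun h1 h2 => ⟨h1, h2.trans hβ⟩
  obtain ⟨t₁, ht₁, hmax₁⟩ := isCompact_Icc.exists_isMaxOn (nonempty_Icc.2 hτ)
    (h.continuousOn.mono (Icc_subset_Icc_right (hτβ.trans hβ)))
  have hmax₁ : ∀ u ∈ Icc 0 τ, g u ≤ g t₁ := fun u hu => hmax₁ hu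
  obtain ⟨t₃, ht₃, hg₃⟩ := intermediate_value_Icc hτβ
    (h.continuousOn.mono (Icc_subset_Icc hτ hβ))
    ⟨hmin t₁ ⟨ht₁.1, ht₁.2.trans hτβ⟩, hmax t₁ ⟨ht₁.1, ht₁.2.trans hτβ⟩⟩
  have m0 : (0 : ℝ) ∈ Icc 0 L := hmem le_rfl (hτ.trans hτβ)
  have m1 : t₁ ∈ Icc 0 L := hmem ht₁.1 (ht₁.2.trans hτβ)
  have mτ : τ ∈ Icc 0 L := hmem hτ hτβ
  have m3 : t₃ ∈ Icc 0 L := hmem (hτ.trans ht₃.1) ht₃.2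
  have mβ : β ∈ Icc 0 L := hmem (hτ.trans hτβ) le_rfl
  -- scale of the errors
  obtain ⟨y, hy⟩ : ∃ y, y = C * δ := ⟨_, rfl⟩
  have hy1 : 1 ≤ y := by rw [hy]; nlinarith
  have hδy : δ ≤ y := by rw [hy]; nlinarith
  have hCy : C ≤ y := by rw [hy]; nlinarith
  rw [← hy]
  obtain ⟨S, hS⟩ : ∃ S, S = 130 * y ^ 2 := ⟨_, rfl⟩
  have hS0 : 0 ≤ S := by rw [hS]; positivity
  -- the pieces which are almost vertical
  have hA := h.excess_le hδ hC mτ m1 fun u hu => by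
    rw [uIcc_comm, uIcc_of_le ht₁.2] at hu
    exact ⟨hmin u ⟨ht₁.1.trans hu.1, hu.2.trans hτβ⟩, hmax₁ u ⟨ht₁.1.trans hu.1, hu.2⟩⟩
  have hB := h.excess_le hδ hC mτ mβ fun u hu => by
    rw [uIcc_of_le hτβ] at hu
    exact ⟨hmin u ⟨hτ.trans hu.1, hu.2⟩, hmax u ⟨hτ.trans hu.1, hu.2⟩⟩
  rw [← hy, ← hS, abs_of_nonneg (sub_nonneg.2 ht₁.2)] at hA
  rw [← hy, ← hS, abs_sub_comm, abs_of_nonneg (sub_nonneg.2 hτβ)] at hB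
  have lip : ∀ {s t}, s ∈ Icc 0 L → t ∈ Icc 0 L → s ≤ t →
      g s - g t ≤ t - s ∧ g t - g s ≤ t - s := fun {s t} hs ht hst => by
    have := h.abs_sub_le hs ht
    rw [abs_sub_comm s, abs_of_nonneg (sub_nonneg.2 hst), abs_le] at this
    exact ⟨this.2, by linarith [this.1]⟩
  -- points of the descending and of the ascending piece
  have desc : ∀ {s t}, t₁ ≤ s → s ≤ t → t ≤ τ → g t ≤ g s →
      dp s t ≤ g s - g t + 2 * S ∧ dq s t ≤ g s - g t + 2 * S := by
    intro s t h1 h2 h3 h4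
    have ms : s ∈ Icc 0 L := hmem (ht₁.1.trans h1) (by linarith)
    have mt : t ∈ Icc 0 L := hmem (ht₁.1.trans (h1.trans h2)) (by linarith)
    have e1 := (lip m1 ms h1).1
    have e2 := (lip mt mτ h3).1
    have e3 := h.left_le_of_le ms mt
    have e4 := h.right_le_of_le ms mt
    rw [abs_sub_comm s, abs_of_nonneg (sub_nonneg.2 h2), abs_of_nonneg (sub_nonneg.2 h4)] at e3 e4
    exact ⟨by linarith, by linarith⟩
  have asc : ∀ {s t}, τ ≤ s → s ≤ t → t ≤ β → g s ≤ g t →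
      dp s t ≤ g t - g s + 2 * S ∧ dq s t ≤ g t - g s + 2 * S := by
    intro s t h1 h2 h3 h4
    have ms : s ∈ Icc 0 L := hmem (hτ.trans h1) (by linarith)
    have mt : t ∈ Icc 0 L := hmem (hτ.trans (h1.trans h2)) (by linarith)
    have e1 := (lip mτ ms h1).2
    have e2 := (lip mt mβ h3).2
    have e3 := h.left_le_of_le ms mt
    have e4 := h.right_le_of_le ms mt
    rw [abs_sub_comm s, abs_of_nonneg (sub_nonneg.2 h2), abs_sub_comm (g s),
      abs_of_nonneg (sub_nonneg.2 h4)] at e3 e4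
    exact ⟨by linarith, by linarith⟩
  have hgτ1 : g τ ≤ g t₁ := hmax₁ τ ⟨hτ, le_rfl⟩
  have across : ∀ {s t}, t₁ ≤ s → s ≤ τ → τ ≤ t → t ≤ β →
      dp s t ≤ |g s - g t| + 4 * S + 8 * δ := by
    intro s t h1 h2 h3 h4
    have ms : s ∈ Icc 0 L := hmem (ht₁.1.trans h1) (by linarith)
    have mt : t ∈ Icc 0 L := hmem (hτ.trans h3) h4
    have e1 := hmin s ⟨ms.1, by linarith⟩
    have e2 := hmin t ⟨mt.1, h4⟩
    have e3 := h.left.join τ mτ s ms t mt e1 e2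
    rw [h.left.symm τ s] at e3
    linarith [(desc h1 h2 le_rfl e1).1, (asc le_rfl h3 h4 e2).1]
  have hdp13 : dp t₁ t₃ ≤ 4 * S + 8 * δ := by
    have := across le_rfl ht₁.2 ht₃.1 ht₃.2
    rwa [hg₃, sub_self, abs_zero, zero_add] at this
  obtain ⟨A', hA'⟩ : ∃ A', A' = g t₁ - g τ := ⟨_, rfl⟩
  have hA'0 : 0 ≤ A' := by linarith
  obtain ⟨S₂, hS₂⟩ : ∃ S₂, S₂ = 4 * δ + C * (8 * S + 28 * δ) := ⟨_, rfl⟩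
  have hCS : 0 ≤ C * (8 * S + 28 * δ) := by positivity
  have hS₂0 : 0 ≤ S₂ := by rw [hS₂]; positivity
  have hQ : 2 * A' - S₂ ≤ dq t₁ t₃ := by
    obtain ⟨a, b, ha, hb, hab, hab', H⟩ := h.right.merge t₁ m1 t₃ m3
    rw [hg₃, show -g t₁ + a - (-g t₁ + b) = a - b by ring, abs_le] at hab
    rcases le_or_gt A' a with h1 | h1
    · linarith
    rcases le_or_gt A' b with h2 | h2
    · linarith
    obtain ⟨s, hs, hgs⟩ := intermediate_value_Icc' ht₁.2
      (h.continuousOn.mono (Icc_subset_Icc ht₁.1 (hτβ.trans hβ)))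
      (show g t₁ - a ∈ Icc (g τ) (g t₁) from ⟨by linarith, by linarith⟩)
    obtain ⟨t, ht, hgt⟩ := intermediate_value_Icc ht₃.1
      (h.continuousOn.mono (Icc_subset_Icc hτ (ht₃.2.trans hβ)))
      (show g t₁ - b ∈ Icc (g τ) (g t₃) from ⟨by linarith, by linarith⟩)
    have ms : s ∈ Icc 0 L := ⟨ht₁.1.trans hs.1, hs.2.trans mτ.2⟩
    have mt : t ∈ Icc 0 L := ⟨hτ.trans ht.1, ht.2.trans m3.2⟩
    have e1 := H s ms t mt (by linarith) (by linarith)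
    have e2 := (desc le_rfl hs.1 hs.2 (by linarith)).2
    have e3 := (asc ht.1 ht.2 ht₃.2 (by linarith)).2
    have e4 := across hs.1 hs.2 ht.1 (ht.2.trans ht₃.2)
    rw [h.right.symm t₃ t] at e1
    have e5 := h.le_relative s ms t mt
    have e6 : |g s - g t| ≤ 2 * δ := by
      rw [hgs, hgt, show g t₁ - a - (g t₁ - b) = b - a by ring, abs_le]
      constructor <;> linarith
    have e7 := abs_nonneg (g s - g t)
    have e8 : C * ((dp s t - |g s - g t|) + (dq s t - |g s - g t|) + 8 * δ) ≤
        C * (8 * S + 28 * δ) :=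
      mul_le_mul_of_nonneg_left (by linarith) (by linarith)
    have e9 := (lip ms mτ hs.2).1
    have e10 := (lip mτ mt ht.1).2
    rw [abs_sub_comm s, abs_of_nonneg (by linarith [hs.2, ht.1])] at e5
    linarith
  have hm1 := h.one_le_right
  obtain ⟨S₃, hS₃⟩ : ∃ S₃, S₃ = 2 * S + S₂ + C * (4 * S + 8 * δ) := ⟨_, rfl⟩
  have hmA : (m - 1) * (2 * A') ≤ S₃ + C * S₂ := by
    have e1 := h.slope_right t₁ m1 t₃ m3
    rw [abs_sub_comm, abs_of_nonneg (by linarith [ht₁.2, ht₃.1])] at e1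
    have e2 : C * dp t₁ t₃ ≤ C * (4 * S + 8 * δ) := by gcongr
    have e3 := (lip m3 mβ ht₃.2).2
    have e4 : (m - 1) * dq t₁ t₃ ≤ S₃ := e1.trans (max_le (by rw [hS₃]; positivity) (by linarith))
    have e5 : (m - 1) * (2 * A') ≤ (m - 1) * (dq t₁ t₃ + S₂) := by
      apply mul_le_mul_of_nonneg_left <;> linarith
    have e6 : (m - 1) * S₂ ≤ C * S₂ := by
      apply mul_le_mul_of_nonneg_right _ hS₂0
      linarith [h.right_le]
    linarith
  -- the excess of the descent to the minimum
  obtain ⟨e, he⟩ : ∃ e, e = τ - (g 0 - g τ) := ⟨_, rfl⟩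
  have hu : g 0 ≤ g t₁ := hmax₁ 0 ⟨le_rfl, hτ⟩
  have hq0 : dq 0 τ ≤ g 0 - g τ + endDefect δ e := by
    have := h.right.end_max 0 m0 τ mτ fun u hu => by
      rw [uIcc_of_le hτ] at hu
      exact neg_le_neg (hmin u ⟨hu.1, hu.2.trans hτβ⟩)
    rwa [neg_sub_neg, zero_sub, abs_neg, abs_of_nonneg hτ, ← he] at this
  have hp0 : dp 0 t₁ ≤ g t₁ - g 0 + endDefect δ e := by
    have := h.left.end_max 0 m0 t₁ m1 fun u hu => by
      rw [uIcc_of_le ht₁.1] at hu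
      exact hmax₁ u ⟨hu.1, hu.2.trans ht₁.2⟩
    rw [zero_sub, abs_neg, abs_of_nonneg ht₁.1] at this
    refine this.trans (add_le_add_right (endDefect_mono hδ ?_ ?_) _)
    · linarith [(lip m0 m1 ht₁.1).2]
    · linarith [(lip m1 mτ ht₁.2).1]
  have he0 : 0 ≤ e := by linarith [(lip m0 mτ hτ).1]
  have hbound : e ≤ 2 ^ 13 * y ^ 4 := by
    have e1 := h.le_right 0 m0 t₃ m3
    rw [zero_sub, abs_neg, abs_of_nonneg m3.1, hg₃, abs_sub_comm,
      abs_of_nonneg (sub_nonneg.2 hu)] at e1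
    have e2 := h.left.tri 0 t₁ t₃
    have e3 := h.right.tri 0 τ t₃
    have e4 := (asc le_rfl ht₃.1 ht₃.2 (by linarith)).2
    have e5 := (lip mτ m3 ht₃.1).2
    have e6 : C * (dp 0 t₃ - (g t₁ - g 0) + 4 * δ) ≤
        C * (endDefect δ e + 4 * S + 12 * δ) :=
      mul_le_mul_of_nonneg_left (by linarith) (by linarith)
    have e7 : m * dq 0 t₃ ≤ m * ((g 0 - g τ + A') + (endDefect δ e + 2 * S)) := by
      gcongr
      linarith
    have hκ0 : 0 ≤ endDefect δ e + 2 * S := by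
      have := h.right.lip 0 m0 τ mτ
      have e8 := (abs_le.1 this).2
      rw [neg_sub_neg] at e8
      have e9 := (abs_le.1 this).1
      rw [neg_sub_neg] at e9
      linarith
    have e8 : m * (endDefect δ e + 2 * S) ≤ C * (endDefect δ e + 2 * S) :=
      mul_le_mul_of_nonneg_right h.right_le hκ0
    have e9 : (m - 1) * (g 0 - g τ + A') ≤ (m - 1) * (2 * A') := by
      apply mul_le_mul_of_nonneg_left <;> linarith
    have e10 : C * endDefect δ e ≤ e / 32 + 55 * y ^ 2 := by
      calc C * endDefect δ e ≤ C * (e / (32 * C) + 55 * C * δ ^ 2) := by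
            gcongr
            exact endDefect_le_linear hδ hC he0
        _ = e / 32 + 55 * y ^ 2 := by rw [hy]; field_simp
    have e11 : e ≤ S₃ + C * S₂ + (e / 16 + 110 * y ^ 2) + C * (6 * S + 12 * δ) := by
      linarith
    have p2 : y ^ 2 ≤ y ^ 4 := pow_le_pow_right₀ hy1 (by norm_num)
    have p3 : y ^ 3 ≤ y ^ 4 := pow_le_pow_right₀ hy1 (by norm_num)
    have p1 : y ≤ y ^ 3 := le_self_pow₀ hy1 (by norm_num)
    have p23 : y ^ 2 ≤ y ^ 3 := pow_le_pow_right₀ hy1 (by norm_num)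
    have hCS' : C * S ≤ 130 * y ^ 3 := by
      rw [hS]
      calc C * (130 * y ^ 2) ≤ y * (130 * y ^ 2) := by gcongr
        _ = 130 * y ^ 3 := by ring
    have b2 : S₂ ≤ 1072 * y ^ 3 := by
      have : C * (8 * S + 28 * δ) = 8 * (C * S) + 28 * y := by rw [hy]; ring
      rw [hS₂, this]
      linarith
    have b2' : C * S₂ ≤ 1072 * y ^ 4 := by
      calc C * S₂ ≤ y * (1072 * y ^ 3) := by gcongr
        _ = 1072 * y ^ 4 := by ring
    have b3 : S₃ ≤ 1860 * y ^ 3 := by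
      have : C * (4 * S + 8 * δ) = 4 * (C * S) + 8 * y := by rw [hy]; ring
      rw [hS₃, this]
      linarith
    have b4 : C * (6 * S + 12 * δ) ≤ 792 * y ^ 3 := by
      have : C * (6 * S + 12 * δ) = 6 * (C * S) + 12 * y := by rw [hy]; ring
      rw [this]
      linarith
    norm_num
    linarith
  have hκ := endDefect_le_of_le hδ hδy he0 hbound
  have hy2 : 0 ≤ y ^ 2 := by positivity
  refine ⟨by linarith, ?_⟩
  have e1 := h.left.tri 0 t₁ β
  have e2 := h.left.tri t₁ t₃ β
  have e3 := (asc ht₃.1 ht₃.2 le_rfl (hmax t₃ ⟨m3.1, ht₃.2⟩)).1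
  nlinarith

theorem exists_extrema_of_le (h : Config δ C m n L g dp dq) (hδ : 1 ≤ δ) (hC : 1 ≤ C) {a b : ℝ}
    (ha : 0 ≤ a) (hab : a ≤ b) (hb : b ≤ L) (hmin : ∀ u ∈ Icc 0 L, g a ≤ g u)
    (hmax : ∀ u ∈ Icc 0 L, g u ≤ g b) :
    dp 0 L ≤ 2 * g b - g 0 - g L + 2 * (882 * (C * δ) ^ 2) ∧
    dq 0 L ≤ g 0 + g L - 2 * g a + 2 * (882 * (C * δ) ^ 2) ∧
    2 * g b - 2 * g a - |g L - g 0| ≤ L := by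
  obtain ⟨h1, h2⟩ := h.first_leg hδ hC ha hab hb (fun u hu => hmin u ⟨hu.1, hu.2.trans hb⟩)
    (fun u hu => hmax u ⟨hu.1, hu.2.trans hb⟩)
  have hrev : ∀ u ∈ Icc 0 (L - a), L - u ∈ Icc 0 L := fun u hu =>
    ⟨by linarith [hu.2], by linarith [hu.1]⟩
  obtain ⟨h3, h4⟩ := h.swap.reverse.first_leg hδ hC (τ := L - b) (β := L - a) (by linarith)
    (by linarith) (by linarith)
    (fun u hu => by simpa using hmax _ (hrev u hu)) (fun u hu => by simpa using hmin _ (hrev u hu))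
  simp only [sub_zero, sub_sub_cancel] at h3 h4
  have m0 : (0 : ℝ) ∈ Icc 0 L := ⟨le_rfl, by linarith⟩
  have mL : L ∈ Icc 0 L := ⟨by linarith, le_rfl⟩
  have ma : a ∈ Icc 0 L := ⟨ha, by linarith⟩
  have mb : b ∈ Icc 0 L := ⟨by linarith, hb⟩
  refine ⟨?_, ?_, ?_⟩
  · have := h.left.tri 0 b L
    rw [h.left.symm b L] at this
    linarith
  · have := h.right.tri 0 a L
    rw [h.right.symm a L] at this
    linarith
  · have e1 := (le_abs_self _).trans (h.abs_sub_le m0 ma)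
    have e2 := (le_abs_self _).trans (h.abs_sub_le mb ma)
    have e3 := (le_abs_self _).trans (h.abs_sub_le mb mL)
    rw [abs_sub_comm, abs_of_nonneg (by linarith)] at e1
    rw [abs_of_nonneg (by linarith)] at e2
    rw [abs_sub_comm, abs_of_nonneg (by linarith)] at e3
    linarith [le_abs_self (g L - g 0)]

theorem exists_extrema (h : Config δ C m n L g dp dq) (hδ : 1 ≤ δ) (hC : 1 ≤ C) (hL : 0 ≤ L) :
    ∃ a ∈ Icc 0 L, ∃ b ∈ Icc 0 L,
      dp 0 L ≤ 2 * g b - g 0 - g L + 2 * (882 * (C * δ) ^ 2) ∧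
      dq 0 L ≤ g 0 + g L - 2 * g a + 2 * (882 * (C * δ) ^ 2) ∧
      2 * g b - 2 * g a - |g L - g 0| ≤ L := by
  obtain ⟨a, ha, hmin⟩ := isCompact_Icc.exists_isMinOn (nonempty_Icc.2 hL) h.continuousOn
  obtain ⟨b, hb, hmax⟩ := isCompact_Icc.exists_isMaxOn (nonempty_Icc.2 hL) h.continuousOn
  refine ⟨a, ha, b, hb, ?_⟩
  rcases le_total a b with hab | hab
  · exact h.exists_extrema_of_le hδ hC ha.1 hab hb.2 (fun u hu => hmin hu) (fun u hu => hmax hu)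
  · obtain ⟨h1, h2, h3⟩ := h.swap.exists_extrema_of_le hδ hC hb.1 hab ha.2
      (fun u hu => neg_le_neg (hmax hu)) (fun u hu => neg_le_neg (hmin hu))
    rw [neg_sub_neg, abs_sub_comm] at h3
    exact ⟨by linarith, by linarith, by linarith⟩

end Config

section Assembly

theorem VertSys.halfConfig {δ L : ℝ} {h : H → ℝ} {V : H → ℝ → H} (hV : VertSys δ h V)
    (hδ : 1 ≤ δ) (hH : DeltaHyperbolic H δ) {p : ℝ → H} {g : ℝ → ℝ}
    (hgp : ∀ t ∈ Icc 0 L, h (p t) = g t)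
    (hp : ∀ s ∈ Icc 0 L, ∀ t ∈ Icc 0 L, dist (p s) (p t) ≤ 2 * |s - t|)
    (hg : ∀ s ∈ Icc 0 L, ∀ t ∈ Icc 0 L, |g s - g t| ≤ |s - t|) :
    HalfConfig δ L g fun s t => dist (p s) (p t) where
  symm s t := dist_comm _ _
  tri s t u := dist_triangle _ _ _
  lip s hs t ht := by
    rw [← hgp s hs, ← hgp t ht]
    exact hV.lip _ _
  end_max s hs t ht hmax := by
    rcases le_total s t with hst | hst
    · rw [uIcc_of_le hst] at hmax
      have hsub : ∀ u ∈ Icc s t, u ∈ Icc 0 L := fun u hu => ⟨hs.1.trans hu.1, hu.2.trans ht.2⟩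
      have := hV.dist_le_of_end_max hδ hH hst
        (fun u hu v hv => hp u (hsub u hu) v (hsub v hv))
        (fun u hu v hv => by
          rw [hgp u (hsub u hu), hgp v (hsub v hv)]
          exact hg u (hsub u hu) v (hsub v hv))
        (fun u hu => by
          rw [hgp u (hsub u hu), hgp t ht]
          exact hmax u hu)
      rwa [hgp s hs, hgp t ht, ← abs_of_nonneg (sub_nonneg.2 hst), abs_sub_comm t] at this
    · rw [uIcc_of_ge hst] at hmax
      have hsub : ∀ u ∈ Icc (-s) (-t), -u ∈ Icc 0 L := fun u hu =>
        ⟨ht.1.trans (by linarith [hu.2]), (by linarith [hu.1] : -u ≤ s).trans hs.2⟩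
      have habs : ∀ u v : ℝ, |-u - -v| = |u - v| := fun u v => by
        rw [neg_sub_neg, abs_sub_comm]
      have := hV.dist_le_of_end_max (p := fun u => p (-u)) hδ hH (neg_le_neg hst)
        (fun u hu v hv => by
          rw [← habs]
          exact hp _ (hsub u hu) _ (hsub v hv))
        (fun u hu v hv => by
          rw [hgp _ (hsub u hu), hgp _ (hsub v hv), ← habs u v]
          exact hg _ (hsub u hu) _ (hsub v hv))
        (fun u hu => by
          rw [hgp _ (hsub u hu), neg_neg, hgp t ht]
          exact hmax _ ⟨by linarith [hu.2], by linarith [hu.1]⟩)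
      simp only [neg_neg] at this
      rwa [hgp s hs, hgp t ht, neg_sub_neg, ← abs_of_nonneg (sub_nonneg.2 hst)] at this
  join z hz s hs t ht hzs hzt := by
    have e1 := hV.dist_vert_le hH.1 (p z) (p s)
    have e2 := hV.dist_vert_le hH.1 (p z) (p t)
    have e3 := hV.isom (p z) (g s - g z) (g t - g z)
    rw [hgp z hz, hgp s hs, dist_comm] at e1
    rw [hgp z hz, hgp t ht] at e2
    rw [sub_sub_sub_cancel_right] at e3
    linarith [dist_triangle4 (p s) (V (p z) (g s - g z)) (V (p z) (g t - g z)) (p t)]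
  merge s hs t ht := by
    obtain ⟨a, b, ha, hb, hd, hab⟩ := hV.exists_merge hH.1 (p s) (p t)
    refine ⟨a, b, ha, hb, ?_, hab, fun s' hs' t' ht' hsa htb => ?_⟩
    · have := hV.lip (V (p s) a) (V (p t) b)
      rw [hV.height, hV.height, hgp s hs, hgp t ht] at this
      exact this.trans hd
    · have e1 := hV.dist_vert_le hH.1 (p s) (p s')
      have e2 := hV.dist_vert_le hH.1 (p t) (p t')
      rw [hgp s hs, hgp s' hs', hsa, add_sub_cancel_left, dist_comm] at e1
      rw [hgp t ht, hgp t' ht', htb, add_sub_cancel_left] at e2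
      linarith [dist_triangle4 (p s') (V (p s) a) (V (p t) b) (p t')]

variable {wp : Hp} {ap : ℝ → Hp} {wq : Hq} {aq : ℝ → Hq} {N : AdmNorm} {L : ℝ} {α : ℝ → Hp × Hq}

theorem IsHNGeodesicOn.norm_le {mem : Hp × Hq → Prop} {I : Set ℝ}
    (hα : IsHNGeodesicOn N.toFun mem α I) {s t : ℝ} (hs : s ∈ I) (ht : t ∈ I) :
    N.toFun (dist (α s).1 (α t).1, dist (α s).2 (α t).2) ≤ |s - t| := by
  rw [← ENNReal.ofReal_le_ofReal_iff (abs_nonneg _), ← hα.2 s hs t ht]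
  exact ofReal_le_dHN

theorem IsHNGeodesicOn.dist_add_dist_le {mem : Hp × Hq → Prop} {I : Set ℝ}
    (hα : IsHNGeodesicOn N.toFun mem α I) {s t : ℝ} (hs : s ∈ I) (ht : t ∈ I) :
    dist (α s).1 (α t).1 + dist (α s).2 (α t).2 ≤ 2 * |s - t| := by
  linarith [hα.norm_le hs ht, N.adm (dist (α s).1 (α t).1) (dist (α s).2 (α t).2)]

theorem IsHNGeodesicOn.continuousOn {mem : Hp × Hq → Prop} {I : Set ℝ}
    (hα : IsHNGeodesicOn N.toFun mem α I) : ContinuousOn α I := by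
  refine (LipschitzOnWith.of_dist_le_mul (K := 2) fun s hs t ht => ?_).continuousOn
  have := hα.dist_add_dist_le hs ht
  rw [Real.dist_eq, NNReal.coe_ofNat, Prod.dist_eq]
  exact max_le (by linarith [dist_nonneg (x := (α s).2) (y := (α t).2)])
    (by linarith [dist_nonneg (x := (α s).1) (y := (α t).1)])

theorem IsHNGeodesicOn.abs_sub_le {I : Set ℝ}
    (hα : IsHNGeodesicOn N.toFun (inHoro wp ap wq aq) α I) {s t r : ℝ} (hs : s ∈ I) (ht : t ∈ I)
    (hr : Reach N (height wp ap) (height wq aq) r (α s) (α t)) : |s - t| ≤ r := by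
  rw [← ENNReal.ofReal_le_ofReal_iff hr.1, ← hα.2 s hs t ht]
  exact hr.dHN_le

theorem IsHNGeodesicOn.ofReal_le_lN {mem : Hp × Hq → Prop} (hL : 0 ≤ L)
    (hα : IsHNGeodesicOn N.toFun mem α (Icc 0 L)) :
    ENNReal.ofReal L ≤ lN N.toFun α (Icc 0 L) := by
  have := hα.2 0 ⟨le_rfl, hL⟩ L ⟨hL, le_rfl⟩
  rw [zero_sub, abs_neg, abs_of_nonneg hL] at this
  rw [← this]
  exact iInf₂_le_of_le L hL <| iInf₂_le_of_le α hα.continuousOn <| iInf₂_le_of_le hα.1 rfl <|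
    iInf_le_of_le rfl le_rfl

theorem IsHNGeodesicOn.config {δ C : ℝ} (hδ : 1 ≤ δ) (hHp : DeltaHyperbolic Hp δ)
    (hHq : DeltaHyperbolic Hq δ) {Vp : Hp → ℝ → Hp} {Vq : Hq → ℝ → Hq}
    (hVp : VertSys δ (height wp ap) Vp) (hVq : VertSys δ (height wq aq) Vq)
    (hC : N.BoundConst C) (hα : IsHNGeodesicOn N.toFun (inHoro wp ap wq aq) α (Icc 0 L)) :
    Config δ C N.rightSlope N.swap.rightSlope L (fun t => height wp ap (α t).1)
      (fun s t => dist (α s).1 (α t).1) (fun s t => dist (α s).2 (α t).2) := by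
  have hq : ∀ t ∈ Icc 0 L, height wq aq (α t).2 = -height wp ap (α t).1 := fun t ht =>
    eq_neg_of_add_eq_zero_right (hα.1 t ht)
  have hqabs : ∀ s ∈ Icc 0 L, ∀ t ∈ Icc 0 L, |height wq aq (α s).2 - height wq aq (α t).2| =
      |height wp ap (α s).1 - height wp ap (α t).1| := fun s hs t ht => by
    rw [hq s hs, hq t ht, neg_sub_neg, abs_sub_comm]
  have hg : ∀ s ∈ Icc 0 L, ∀ t ∈ Icc 0 L,
      |height wp ap (α s).1 - height wp ap (α t).1| ≤ |s - t| := fun s hs t ht => by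
    have h1 := hVp.lip (α s).1 (α t).1
    have h2 := hVq.lip (α s).2 (α t).2
    rw [hqabs s hs t ht] at h2
    linarith [hα.dist_add_dist_le hs ht]
  have hCpos : 0 ≤ C := by linarith [hC.1]
  constructor
  · exact hVp.halfConfig hδ hHp (fun t _ => rfl) (fun s hs t ht => by
      linarith [hα.dist_add_dist_le hs ht, dist_nonneg (x := (α s).2) (y := (α t).2)]) hg
  · refine hVq.halfConfig hδ hHq hq (fun s hs t ht => by
      linarith [hα.dist_add_dist_le hs ht, dist_nonneg (x := (α s).1) (y := (α t).1)]) ?_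
    intro s hs t ht
    rw [neg_sub_neg, abs_sub_comm]
    exact hg s hs t ht
  · exact fun s hs t ht => hα.dist_add_dist_le hs ht
  · intro s hs t ht
    rcases le_total (height wp ap (α s).1) (height wp ap (α t).1) with hst | hst
    · obtain ⟨r, hr, h⟩ := Reach.of_relative_dist hC hHp.1 hHq.1 hVp hVq (hα.1 s hs) (hα.1 t ht)
        hst
      rw [abs_sub_comm (height wp ap _), abs_of_nonneg (sub_nonneg.2 hst)]
      exact (hα.abs_sub_le hs ht h).trans hr
    · obtain ⟨r, hr, h⟩ := Reach.of_relative_dist hC hHp.1 hHq.1 hVp hVq (hα.1 t ht) (hα.1 s hs)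
        hst
      rw [abs_of_nonneg (sub_nonneg.2 hst), dist_comm (α s).1, dist_comm (α s).2, abs_sub_comm]
      exact (hα.abs_sub_le ht hs h).trans hr
  · intro s hs t ht
    obtain ⟨r, hr, h⟩ := Reach.of_dist_right hC hHp.1 hHq.1 hVp hVq (hα.1 s hs) (hα.1 t ht)
    exact (hα.abs_sub_le hs ht h).trans hr
  · intro s hs t ht
    obtain ⟨r, hr, h⟩ := Reach.of_dist_left hC hHp.1 hHq.1 hVp hVq (hα.1 s hs) (hα.1 t ht)
    rw [hqabs s hs t ht] at hr
    exact (hα.abs_sub_le hs ht h).trans hr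
  · exact fun s hs t ht =>
      hC.rightSlope_sub_one_mul_le dist_nonneg dist_nonneg (hα.norm_le hs ht)
  · exact fun s hs t ht =>
      hC.swap.rightSlope_sub_one_mul_le dist_nonneg dist_nonneg (hα.norm_le hs ht)
  · exact le_max_left _ _
  · exact le_max_left _ _
  · exact hC.rightSlope_le
  · exact hC.swap.rightSlope_le

end Assembly

/-- Lower bound on the length of a geodesic segment of the
horospherical product, together with bounds on its maximal and minimal heights. -/
theorem statement12 {Hp Hq : Type*} [MetricSpace Hp] [MetricSpace Hq]
    [ProperSpace Hp] [ProperSpace Hq]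
    (δ : ℝ) (hδ : 1 ≤ δ)
    (hHp : DeltaHyperbolic Hp δ) (hHq : DeltaHyperbolic Hq δ)
    (hBp : BusemannSpace Hp) (hBq : BusemannSpace Hq)
    (hGp : GeodesicallyComplete Hp) (hGq : GeodesicallyComplete Hq)
    (wp : Hp) (ap : ℝ → Hp) (hap : IsRayFrom wp ap)
    (wq : Hq) (aq : ℝ → Hq) (haq : IsRayFrom wq aq)
    (N : AdmNorm) (CN : ℝ) (hCN : N.BoundConst CN)
    (C₀ : ℝ) (hC₀ : C₀ = (2853 * δ * CN + 2 ^ (851:ℕ)) ^ 2)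
    (x y : Hp × Hq) (hx : inHoro wp ap wq aq x) (hy : inHoro wp ap wq aq y)
    (hxy : height wp ap x.1 ≤ height wp ap y.1)
    (L : ℝ) (hL : 0 ≤ L) (α : ℝ → Hp × Hq)
    (hα : IsHNGeodesicOn N.toFun (inHoro wp ap wq aq) α (Set.Icc 0 L))
    (hα0 : α 0 = x) (hαL : α L = y) :
    ENNReal.ofReal (|height wp ap x.1 - height wp ap y.1|
        + dr wq aq x.2 y.2 + dr wp ap x.1 y.1 - 15 * C₀)
      ≤ lN N.toFun α (Set.Icc 0 L) ∧
    height wp ap y.1 + dr wp ap x.1 y.1 / 2 - 3 * C₀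
      ≤ hplusH wp ap α (Set.Icc 0 L) ∧
    hminusH wp ap α (Set.Icc 0 L)
      ≤ height wp ap x.1 - dr wq aq x.2 y.2 / 2 + 3 * C₀ := by
  subst hα0 hαL
  obtain ⟨Vp, hVp⟩ := exists_vertSys (by linarith) hHp hBp hGp hap
  obtain ⟨Vq, hVq⟩ := exists_vertSys (by linarith) hHq hBq hGq haq
  have hcfg := hα.config hδ hHp hHq hVp hVq hCN
  obtain ⟨a, ha, b, hb, h1, h2, h3⟩ := hcfg.exists_extrema hδ hCN.1 hL
  have hK : 882 * (CN * δ) ^ 2 ≤ C₀ := by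
    have h4 : 0 ≤ CN * δ := mul_nonneg (by linarith [hCN.1]) (by linarith)
    have h5 : (0 : ℝ) ≤ 2 ^ (851 : ℕ) := by positivity
    have h6 : (2853 * (CN * δ)) ^ 2 ≤ C₀ := by
      rw [hC₀, mul_assoc, mul_comm δ]
      exact pow_le_pow_left₀ (by linarith) (le_add_of_nonneg_right h5) 2
    rw [mul_pow] at h6
    norm_num at h6
    clear hC₀ h5
    have h7 := sq_nonneg (CN * δ)
    linarith
  have hC₀0 : 0 ≤ C₀ := hC₀ ▸ sq_nonneg _
  have hqx : height wq aq (α 0).2 = -height wp ap (α 0).1 := eq_neg_of_add_eq_zero_right hx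
  have hqy : height wq aq (α L).2 = -height wp ap (α L).1 := eq_neg_of_add_eq_zero_right hy
  have hΔ : |height wp ap (α 0).1 - height wp ap (α L).1| =
      height wp ap (α L).1 - height wp ap (α 0).1 := by
    rw [abs_sub_comm, abs_of_nonneg (sub_nonneg.2 hxy)]
  have hcompact := isCompact_Icc.image_of_continuousOn hcfg.continuousOn
  rw [abs_of_nonneg (sub_nonneg.2 hxy)] at h3
  have hbmax := le_csSup hcompact.bddAbove (mem_image_of_mem _ hb)
  have hamin := csInf_le hcompact.bddBelow (mem_image_of_mem _ ha)
  simp only [dr, dh, hqx, hqy, neg_sub_neg, abs_sub_comm (height wp ap (α L).1), hΔ]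
  refine ⟨(ENNReal.ofReal_le_ofReal ?_).trans (hα.ofReal_le_lN hL), ?_, ?_⟩
  · linarith
  · rw [hplusH]
    linarith
  · rw [hminusH]
    linarith

end HP

end
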